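/- arXiv:2007.04412 — 15 statements merged into one kernel-verified Lean document; each statement's English description precedes it below -/
import Mathlib

section
/- Let γ : ℝ → ℝ² be a smooth curve and t₀ ∈ ℝ a point with ⟨γ'(t₀),γ'(t₀)⟩ ≠ 0 (γ is non-lightlike at t₀) and ⟨γ''(t₀),γ'(t₀)^⊥⟩ ≠ 0 (t₀ is not an inflection), and let e be the evolute of γ, which is defined and smooth on a neighborhood of t₀. Then there exists ε > 0 such that for all t, t' ∈ (t₀−ε, t₀+ε) with t ≠ t₀ one has det(γ'(t₀), γ(t) − γ(t₀)) · det(γ'(t₀), e(t') − γ(t₀)) < 0, where det((a,b),(c,d)) = ad − bc; that is, near t₀ the evolute lies strictly in the open half-plane determined by the tangent line of γ at t₀ which does not contain the curve γ. -/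
open Filter Topology

/-- Minkowski pseudo-scalar product on ℝ²: ⟨u,v⟩ = -u₁v₁ + u₂v₂. -/
noncomputable def mink (u v : ℝ × ℝ) : ℝ := -(u.1 * v.1) + u.2 * v.2

/-- The perp operation u^⊥ = (u₂, u₁). -/
noncomputable def perp (u : ℝ × ℝ) : ℝ × ℝ := (u.2, u.1)

/-- det((a,b),(c,d)) = ad - bc. -/
noncomputable def pdet (u v : ℝ × ℝ) : ℝ := u.1 * v.2 - u.2 * v.1

lemma eventually_lt_of_deriv_deriv_pos {f : ℝ → ℝ} {x₀ : ℝ} (hf : Continuous f)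
    (hf₂ : ContinuousAt (deriv (deriv f)) x₀) (hd : deriv f x₀ = 0)
    (hpos : 0 < deriv (deriv f) x₀) : ∀ᶠ x in 𝓝 x₀, x ≠ x₀ → f x₀ < f x := by
  obtain ⟨δ, hδ, hball⟩ := Metric.eventually_nhds_iff_ball.1 (hf₂.eventually_const_lt hpos)
  have hconv : StrictConvexOn ℝ (Metric.ball x₀ δ) f :=
    strictConvexOn_of_deriv2_pos (convex_ball x₀ δ) hf.continuousOn fun x hx =>
      hball x (interior_subset hx)
  have hmem : x₀ ∈ Metric.ball x₀ δ := Metric.mem_ball_self hδ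
  have hmin : IsMinOn f (Metric.ball x₀ δ) x₀ :=
    IsMinOn.of_isLocalMinOn_of_convexOn hmem
      ((isLocalMin_of_deriv_deriv_pos hpos hd hf.continuousAt).on _) hconv.convexOn
  filter_upwards [Metric.ball_mem_nhds x₀ hδ] with x hx hne
  refine lt_of_le_of_ne (hmin hx) fun heq => hne ?_
  exact hconv.eq_of_isMinOn (fun y hy => heq ▸ hmin hy) hmin hx hmem

lemma HasDerivAt.pdet_const_left {c : ℝ → ℝ × ℝ} {c' : ℝ × ℝ} {t : ℝ} (v : ℝ × ℝ)
    (hc : HasDerivAt c c' t) : HasDerivAt (fun s => pdet v (c s)) (pdet v c') t := by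
  have h₁ : HasDerivAt (fun s => (c s).1) c'.1 t :=
    (ContinuousLinearMap.fst ℝ ℝ ℝ).hasFDerivAt.comp_hasDerivAt t hc
  have h₂ : HasDerivAt (fun s => (c s).2) c'.2 t :=
    (ContinuousLinearMap.snd ℝ ℝ ℝ).hasFDerivAt.comp_hasDerivAt t hc
  exact (h₂.const_mul v.1).sub (h₁.const_mul v.2)

lemma Continuous.pdet {X : Type*} [TopologicalSpace X] {u v : X → ℝ × ℝ}
    (hu : Continuous u) (hv : Continuous v) : Continuous fun x => pdet (u x) (v x) := by
  unfold _root_.pdet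
  fun_prop

lemma mink_perp_eq_pdet (u v : ℝ × ℝ) : mink u (perp v) = pdet v u := by
  simp only [mink, perp, pdet]
  ring

lemma pdet_smul_perp (a : ℝ) (v : ℝ × ℝ) : pdet v (a • perp v) = -(a * mink v v) := by
  simp only [mink, perp, pdet, Prod.smul_fst, Prod.smul_snd, smul_eq_mul]
  ring

/-- Near a non-lightlike, non-inflection point the evolute lies strictly in the open
half-plane determined by the tangent line of γ at t₀ which does not contain the curve. -/
theorem stmt_0 (γ e : ℝ → ℝ × ℝ) (hγ : ContDiff ℝ (⊤ : ℕ∞) γ) (t₀ : ℝ)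
    (hnl : mink (deriv γ t₀) (deriv γ t₀) ≠ 0)
    (hni : mink (deriv (deriv γ) t₀) (perp (deriv γ t₀)) ≠ 0)
    (he : ∀ t, e t = γ t + (mink (deriv γ t) (deriv γ t) /
      mink (deriv (deriv γ) t) (perp (deriv γ t))) • perp (deriv γ t)) :
    ∃ ε > 0, ∀ t t' : ℝ, |t - t₀| < ε → |t' - t₀| < ε → t ≠ t₀ →
      pdet (deriv γ t₀) (γ t - γ t₀) * pdet (deriv γ t₀) (e t' - γ t₀) < 0 := by
  have hγ₁ : ContDiff ℝ (⊤ : ℕ∞) (deriv γ) := by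
    simpa using hγ.iterate_deriv 1
  have hγ₂ : ContDiff ℝ (⊤ : ℕ∞) (deriv (deriv γ)) := by
    simpa using hγ₁.iterate_deriv 1
  have hd₁ (t : ℝ) : HasDerivAt γ (deriv γ t) t :=
    (hγ.differentiable (by simp) t).hasDerivAt
  have hd₂ (t : ℝ) : HasDerivAt (deriv γ) (deriv (deriv γ) t) t :=
    (hγ₁.differentiable (by simp) t).hasDerivAt
  set v := deriv γ t₀ with hv
  set D := pdet v (deriv (deriv γ) t₀) with hD
  rw [mink_perp_eq_pdet, ← hD] at hni
  have hf₁ : deriv (fun t => D * pdet v (γ t - γ t₀)) = fun t => D * pdet v (deriv γ t) :=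
    funext fun t => ((((hd₁ t).sub_const _).pdet_const_left v).const_mul D).deriv
  have hf₂ : deriv (fun t => D * pdet v (deriv γ t)) =
      fun t => D * pdet v (deriv (deriv γ) t) :=
    funext fun t => (((hd₂ t).pdet_const_left v).const_mul D).deriv
  have hcurve : ∀ᶠ t in 𝓝 t₀, t ≠ t₀ → 0 < D * pdet v (γ t - γ t₀) := by
    have h := eventually_lt_of_deriv_deriv_pos (f := fun t => D * pdet v (γ t - γ t₀)) (x₀ := t₀)
      (continuous_const.mul (continuous_const.pdet (hγ.continuous.sub continuous_const)))
      (by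
        rw [hf₁, hf₂]
        exact (continuous_const.mul (continuous_const.pdet hγ₂.continuous)).continuousAt)
      (by
        rw [hf₁]
        simp only [← hv, pdet]
        ring)
      (by
        rw [hf₁, hf₂]
        exact mul_self_pos.2 hni)
    simpa [pdet] using h
  have hevolute : ∀ᶠ t in 𝓝 t₀, D * pdet v (e t - γ t₀) < 0 := by
    have hcont : ContinuousAt e t₀ := by
      rw [funext he]
      have hc₁ := hγ₁.continuous
      have hnum : Continuous fun t => mink (deriv γ t) (deriv γ t) := by
        unfold mink
        fun_prop
      have hperp : Continuous fun t => perp (deriv γ t) := by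
        unfold perp
        fun_prop
      simp only [mink_perp_eq_pdet]
      have hquot : ContinuousAt (fun t => mink (deriv γ t) (deriv γ t) /
          pdet (deriv γ t) (deriv (deriv γ) t)) t₀ := ContinuousAt.div hnum.continuousAt
        (hc₁.pdet hγ₂.continuous).continuousAt hni
      exact ContinuousAt.fun_add hγ.continuous.continuousAt
        (ContinuousAt.fun_smul hquot hperp.continuousAt)
    have hcont' : ContinuousAt (fun t => D * pdet v (e t - γ t₀)) t₀ := by
      unfold pdet
      fun_prop
    refine hcont'.eventually_lt_const ?_
    have hval : D * pdet v (e t₀ - γ t₀) = -(mink v v * mink v v) := by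
      rw [he t₀, add_sub_cancel_left, ← hv, pdet_smul_perp, mink_perp_eq_pdet, ← hD]
      field_simp
    exact hval.trans_lt <| neg_neg_of_pos (mul_self_pos.2 hnl)
  obtain ⟨ε, hε, hball⟩ := Metric.eventually_nhds_iff.1 (hcurve.and hevolute)
  refine ⟨ε, hε, fun t t' ht ht' hne => ?_⟩
  have hneg := mul_neg_of_pos_of_neg ((hball (y := t) ht).1 hne) (hball (y := t') ht').2
  have hDD : 0 < D * D := mul_self_pos.2 hni
  refine neg_of_mul_neg_right ?_ hDD.le
  linarith
end

section
/- Let γ, T, N : ℝ → ℝ² be smooth maps and κ : ℝ → ℝ a smooth function with κ(t) ≠ 0 for t in a neighborhood of t₀, satisfying the Minkowski Frenet equations γ' = T, T' = κ·N and N' = κ·T, and let e = γ − (1/κ)·N be the evolute. If κ'(t₀) = 0 (γ has a vertex at t₀), then e'(t₀) = 0, e''(t₀) = (κ''(t₀)/κ(t₀)²)·N(t₀), and e'''(t₀) = (2κ''(t₀)/κ(t₀))·T(t₀) + (κ'''(t₀)/κ(t₀)²)·N(t₀). -/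
open Filter Topology

/-- At a vertex (κ'(t₀) = 0) of a unit-speed non-lightlike curve in the Minkowski plane
satisfying the Frenet equations γ' = T, T' = κN, N' = κT, the evolute e = γ - (1/κ)N
satisfies e'(t₀) = 0, e''(t₀) = (κ''(t₀)/κ(t₀)²)N(t₀) and
e'''(t₀) = (2κ''(t₀)/κ(t₀))T(t₀) + (κ'''(t₀)/κ(t₀)²)N(t₀). -/
theorem stmt_1 (γ T N : ℝ → ℝ × ℝ) (κ : ℝ → ℝ) (t₀ : ℝ)
    (hγ : ContDiff ℝ (⊤ : ℕ∞) γ) (hT : ContDiff ℝ (⊤ : ℕ∞) T) (hN : ContDiff ℝ (⊤ : ℕ∞) N)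
    (hκs : ContDiff ℝ (⊤ : ℕ∞) κ)
    (hκ : ∀ᶠ t in 𝓝 t₀, κ t ≠ 0)
    (h1 : deriv γ = T)
    (h2 : ∀ t, deriv T t = κ t • N t)
    (h3 : ∀ t, deriv N t = κ t • T t)
    (e : ℝ → ℝ × ℝ) (he : ∀ t, e t = γ t - (κ t)⁻¹ • N t)
    (hv : deriv κ t₀ = 0) :
    deriv e t₀ = 0 ∧
    iteratedDeriv 2 e t₀ = (iteratedDeriv 2 κ t₀ / (κ t₀)^2) • N t₀ ∧
    iteratedDeriv 3 e t₀ = (2 * iteratedDeriv 2 κ t₀ / κ t₀) • T t₀ +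
      (iteratedDeriv 3 κ t₀ / (κ t₀)^2) • N t₀ := by
  have dγ (t : ℝ) : HasDerivAt γ (T t) t := by
    simpa [h1] using (hγ.differentiable (by simp) t).hasDerivAt
  have dT (t : ℝ) : HasDerivAt T (κ t • N t) t := by
    simpa [h2] using (hT.differentiable (by simp) t).hasDerivAt
  have dN (t : ℝ) : HasDerivAt N (κ t • T t) t := by
    simpa [h3] using (hN.differentiable (by simp) t).hasDerivAt
  have dκ (n : ℕ) (t : ℝ) :
      HasDerivAt (iteratedDeriv n κ) (iteratedDeriv (n + 1) κ t) t := by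
    rw [iteratedDeriv_succ]
    exact (hκs.differentiable_iteratedDeriv n (by exact_mod_cast WithTop.coe_lt_top n) t).hasDerivAt
  have dκ₀ (t : ℝ) : HasDerivAt κ (iteratedDeriv 1 κ t) t := by
    simpa using dκ 0 t
  have hv' : iteratedDeriv 1 κ t₀ = 0 := by simpa [iteratedDeriv_one] using hv
  have e₁ (t : ℝ) (ht : κ t ≠ 0) :
      HasDerivAt e ((iteratedDeriv 1 κ t / κ t ^ 2) • N t) t := by
    rw [funext he]
    refine HasDerivAt.congr_deriv ((dγ t).sub (((dκ₀ t).inv ht).smul (dN t))) ?_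
    simp only [Pi.inv_apply]
    rw [smul_smul, inv_mul_cancel₀ ht]
    module
  have e₂ (t : ℝ) (ht : κ t ≠ 0) :
      HasDerivAt (fun t ↦ (iteratedDeriv 1 κ t / κ t ^ 2) • N t)
        ((iteratedDeriv 1 κ t / κ t) • T t +
          (iteratedDeriv 2 κ t / κ t ^ 2 - 2 * iteratedDeriv 1 κ t ^ 2 / κ t ^ 3) • N t) t := by
    refine HasDerivAt.congr_deriv (((dκ 1 t).div ((dκ₀ t).pow 2) (pow_ne_zero 2 ht)).smul (dN t)) ?_
    simp only [Pi.div_apply, Pi.pow_apply]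
    rw [smul_smul]
    congr 2 <;> field_simp
    norm_num
    ring
  have e₃ : HasDerivAt (fun t ↦ (iteratedDeriv 1 κ t / κ t) • T t +
          (iteratedDeriv 2 κ t / κ t ^ 2 - 2 * iteratedDeriv 1 κ t ^ 2 / κ t ^ 3) • N t)
        ((2 * iteratedDeriv 2 κ t₀ / κ t₀) • T t₀ +
          (iteratedDeriv 3 κ t₀ / κ t₀ ^ 2) • N t₀) t₀ := by
    have ht := hκ.self_of_nhds
    refine HasDerivAt.congr_deriv ((((dκ 1 t₀).div (dκ₀ t₀) ht).smul (dT t₀)).add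
      ((((dκ 2 t₀).div ((dκ₀ t₀).pow 2) (pow_ne_zero 2 ht)).sub
        ((((dκ 1 t₀).pow 2).const_mul 2).div ((dκ₀ t₀).pow 3) (pow_ne_zero 3 ht))).smul
          (dN t₀))) ?_
    simp [hv, smul_smul]
    match_scalars <;> field_simp
    ring
  have E₁ : deriv e =ᶠ[𝓝 t₀] fun t ↦ (iteratedDeriv 1 κ t / κ t ^ 2) • N t :=
    hκ.mono fun t ht ↦ (e₁ t ht).deriv
  have E₂ : iteratedDeriv 2 e =ᶠ[𝓝 t₀] fun t ↦ (iteratedDeriv 1 κ t / κ t) • T t +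
      (iteratedDeriv 2 κ t / κ t ^ 2 - 2 * iteratedDeriv 1 κ t ^ 2 / κ t ^ 3) • N t := by
    rw [iteratedDeriv_succ, iteratedDeriv_one]
    exact E₁.deriv.trans (hκ.mono fun t ht ↦ (e₂ t ht).deriv)
  refine ⟨?_, ?_, ?_⟩
  · simp [E₁.eq_of_nhds, hv']
  · simp [E₂.eq_of_nhds, hv']
  · rw [iteratedDeriv_succ, E₂.deriv_eq, e₃.deriv]
end

section
/- Let f : ℝ → ℝ be smooth with f(0) = f'(0) = f''(0) = 0 and f'''(0) = 6c₃ for some c₃ ≠ 0, so that the timelike curve γ(t) = (t, f(t)) has an ordinary inflection at t = 0. Then f''(t) ≠ 0 for all sufficiently small t ≠ 0, and the evolute e(t) = (t − f'(t)(1 − f'(t)²)/f''(t), f(t) − (1 − f'(t)²)/f''(t)) satisfies lim_{t→0} e₁(t)/t = 1/2 and lim_{t→0} t·e₂(t) = −1/(6c₃); in particular the evolute tends to infinity asymptotically along the normal line of γ at 0 and can be modeled by xy = 1 in suitable coordinates. -/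
open Filter Topology

/-- If `g` vanishes at `0` and `g'` is equivalent to `a * t` at `0`, then `g` is equivalent to
`a / 2 * t ^ 2` at `0`. -/
theorem tendsto_div_sq_of_hasDerivAt {g g' : ℝ → ℝ} {a : ℝ} (hg : ∀ t, HasDerivAt g (g' t) t)
    (hg0 : g 0 = 0) (h : Tendsto (fun t => g' t / t) (𝓝[≠] 0) (𝓝 a)) :
    Tendsto (fun t => g t / t ^ 2) (𝓝[≠] 0) (𝓝 (a / 2)) := by
  refine HasDerivAt.lhopital_zero_nhdsNE (f' := g') (g' := fun t => 2 * t)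
    (Eventually.of_forall hg) (Eventually.of_forall fun t => ?_) ?_ ?_ ?_ ?_
  · simpa using hasDerivAt_pow 2 t
  · filter_upwards [self_mem_nhdsWithin] with t ht
    exact mul_ne_zero two_ne_zero ht
  · simpa [hg0] using (hg 0).continuousAt.tendsto.mono_left nhdsWithin_le_nhds
  · have : Tendsto (fun t : ℝ => t ^ 2) (𝓝 0) (𝓝 (0 ^ 2)) := (continuous_pow 2).tendsto 0
    simpa using this.mono_left nhdsWithin_le_nhds
  · refine (h.div_const 2).congr fun t => ?_
    rw [div_div, mul_comm]

/-- At an ordinary inflection of the timelike curve γ(t) = (t, f(t)) at t = 0, the evolute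
tends to infinity asymptotically along the normal line: e₁(t)/t → 1/2 and t·e₂(t) → -1/(6c₃). -/
theorem stmt_2 (f : ℝ → ℝ) (hf : ContDiff ℝ (⊤ : ℕ∞) f) (c₃ : ℝ) (hc₃ : c₃ ≠ 0)
    (h0 : f 0 = 0) (h1 : deriv f 0 = 0) (h2 : iteratedDeriv 2 f 0 = 0)
    (h3 : iteratedDeriv 3 f 0 = 6 * c₃)
    (e₁ e₂ : ℝ → ℝ)
    (he₁ : ∀ t, e₁ t = t - deriv f t * (1 - (deriv f t)^2) / iteratedDeriv 2 f t)
    (he₂ : ∀ t, e₂ t = f t - (1 - (deriv f t)^2) / iteratedDeriv 2 f t) :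
    (∀ᶠ t in 𝓝[≠] (0:ℝ), iteratedDeriv 2 f t ≠ 0) ∧
    Tendsto (fun t => e₁ t / t) (𝓝[≠] (0:ℝ)) (𝓝 (1/2)) ∧
    Tendsto (fun t => t * e₂ t) (𝓝[≠] (0:ℝ)) (𝓝 (-1/(6*c₃))) := by
  have hd0 : Differentiable ℝ f := hf.differentiable (by simp)
  have hd1 : ∀ t, HasDerivAt (deriv f) (iteratedDeriv 2 f t) t := fun t => by
    have h := (hf.differentiable_iteratedDeriv 1
      (WithTop.coe_lt_coe.2 (ENat.natCast_lt_top 1)) t).hasDerivAt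
    rwa [← iteratedDeriv_succ, iteratedDeriv_one] at h
  have hd2 : HasDerivAt (iteratedDeriv 2 f) (6 * c₃) 0 := by
    have h := (hf.differentiable_iteratedDeriv 2
      (WithTop.coe_lt_coe.2 (ENat.natCast_lt_top 2)) 0).hasDerivAt
    rwa [← iteratedDeriv_succ, h3] at h
  have hc : 6 * c₃ ≠ 0 := mul_ne_zero (by norm_num) hc₃
  have hF2 : Tendsto (fun t => iteratedDeriv 2 f t / t) (𝓝[≠] 0) (𝓝 (6 * c₃)) := by
    refine (hasDerivAt_iff_tendsto_slope.1 hd2).congr fun t => ?_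
    simp [slope_def_field, h2]
  have hF1 := tendsto_div_sq_of_hasDerivAt hd1 h1 hF2
  have hne : ∀ᶠ t in 𝓝[≠] (0 : ℝ), iteratedDeriv 2 f t ≠ 0 := by
    filter_upwards [hF2.eventually_ne hc] with t ht h
    simp [h] at ht
  have hS : Tendsto (fun t => 1 - deriv f t ^ 2) (𝓝[≠] 0) (𝓝 1) := by
    have h := ((hd1 0).continuousAt.tendsto.pow 2).const_sub 1
    simpa [h1] using h.mono_left nhdsWithin_le_nhds
  have hT : Tendsto (fun t => t * f t) (𝓝[≠] 0) (𝓝 0) := by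
    have h := (continuous_id'.mul hd0.continuous).tendsto 0
    simpa [Pi.mul_def] using h.mono_left nhdsWithin_le_nhds
  refine ⟨hne, ?_, ?_⟩
  · have h := ((hF1.mul hS).div hF2 hc).const_sub 1
    rw [show 1 - 6 * c₃ / 2 * 1 / (6 * c₃) = 1 / 2 by field_simp; norm_num] at h
    refine h.congr' ?_
    filter_upwards [hne, self_mem_nhdsWithin] with t ht (ht0 : t ≠ 0)
    simp only [Pi.div_apply, he₁]
    field_simp
  · have h := hT.sub (hS.div hF2 hc)
    rw [show 0 - 1 / (6 * c₃) = -1 / (6 * c₃) by ring] at h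
    refine h.congr' ?_
    filter_upwards [hne, self_mem_nhdsWithin] with t ht (ht0 : t ≠ 0)
    simp only [Pi.div_apply, he₂]
    field_simp
end

section
/- Let k ≥ 1 be an integer and f : ℝ → ℝ smooth with f'(0) = 1 and f^{(i)}(0) = 0 for all 2 ≤ i ≤ k+1 (so the curve γ(t) = (t, f(t)) has a lightlike inflection of order at least k at t = 0). Let g = f'''·(1 − (f')²) + 3·f'·(f'')². Then g^{(n)}(0) = 0 for all 0 ≤ n ≤ 2k−1; that is, γ has a vertex of order at least 2k at t = 0, so in the jet space the stratum of lightlike inflections of order k is contained in the stratum of vertices of order 2k (LI(k) ⊆ V(2k)). -/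
/-- The derivatives of a product vanish up to the sum of the orders of vanishing of the factors. -/
theorem iteratedDeriv_mul_eq_zero_of_lt_add {u v : ℝ → ℝ} {x : ℝ} {a b : ℕ}
    (hu : ContDiff ℝ (⊤ : ℕ∞) u) (hv : ContDiff ℝ (⊤ : ℕ∞) v)
    (hua : ∀ i < a, iteratedDeriv i u x = 0) (hvb : ∀ i < b, iteratedDeriv i v x = 0)
    {n : ℕ} (hn : n < a + b) : iteratedDeriv n (u * v) x = 0 := by
  have hle : (n : WithTop ℕ∞) ≤ ((⊤ : ℕ∞) : WithTop ℕ∞) := by exact_mod_cast le_top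
  rw [iteratedDeriv_mul ((hu.of_le hle).contDiffAt) ((hv.of_le hle).contDiffAt)]
  refine Finset.sum_eq_zero fun i hi => ?_
  rw [Finset.mem_range] at hi
  rcases lt_or_ge i a with h | h
  · rw [hua i h]; ring
  · rw [hvb (n - i) (by omega)]; ring

/-- The iterated derivatives of an iterated derivative. -/
theorem iteratedDeriv_iteratedDeriv_eq (m n : ℕ) (f : ℝ → ℝ) :
    iteratedDeriv m (iteratedDeriv n f) = iteratedDeriv (m + n) f := by
  simp only [iteratedDeriv_eq_iterate, Function.iterate_add_apply]

/-- A lightlike inflection of order at least k at t = 0 of γ(t) = (t, f(t)) gives a vertex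
of order at least 2k: g⁽ⁿ⁾(0) = 0 for all 0 ≤ n ≤ 2k-1, where
g = f'''·(1 - (f')²) + 3·f'·(f'')². Hence LI(k) ⊆ V(2k). -/
theorem stmt_4 (k : ℕ) (hk : 1 ≤ k) (f : ℝ → ℝ) (hf : ContDiff ℝ (⊤ : ℕ∞) f)
    (h1 : deriv f 0 = 1)
    (hi : ∀ i, 2 ≤ i → i ≤ k + 1 → iteratedDeriv i f 0 = 0)
    (g : ℝ → ℝ)
    (hg : ∀ t, g t = iteratedDeriv 3 f t * (1 - (deriv f t)^2) +
      3 * deriv f t * (iteratedDeriv 2 f t)^2) :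
    ∀ n, n ≤ 2*k - 1 → iteratedDeriv n g 0 = 0 := by
  have hle (n : ℕ) : (n : WithTop ℕ∞) ≤ ((⊤ : ℕ∞) : WithTop ℕ∞) := by exact_mod_cast le_top
  have hsm (m : ℕ) : ContDiff ℝ (⊤ : ℕ∞) (iteratedDeriv m f) := by
    rw [iteratedDeriv_eq_iterate]
    exact hf.iterate_deriv m
  have hd : ContDiff ℝ (⊤ : ℕ∞) (deriv f) := by simpa [iteratedDeriv_one] using hsm 1
  have hu : ContDiff ℝ (⊤ : ℕ∞) (fun t => 1 - deriv f t) := contDiff_const.sub hd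
  have hw : ContDiff ℝ (⊤ : ℕ∞) (fun t => 1 + deriv f t) := contDiff_const.add hd
  have hc : ContDiff ℝ (⊤ : ℕ∞) (fun t => 3 * deriv f t) := contDiff_const.mul hd
  have hu0 : ∀ i < k + 1, iteratedDeriv i (fun t => 1 - deriv f t) 0 = 0 := by
    intro i hik
    rcases i with _ | i
    · simp [h1]
    · rw [iteratedDeriv_const_sub (Nat.succ_pos i), iteratedDeriv_neg,
        ← iteratedDeriv_succ', hi (i + 1 + 1) (by omega) (by omega), neg_zero]
  have h20 : ∀ i < k, iteratedDeriv i (iteratedDeriv 2 f) 0 = 0 := fun i hik => by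
    rw [iteratedDeriv_iteratedDeriv_eq, hi _ (by omega) (by omega)]
  have h30 : ∀ i < k - 1, iteratedDeriv i (iteratedDeriv 3 f) 0 = 0 := fun i hik => by
    rw [iteratedDeriv_iteratedDeriv_eq, hi _ (by omega) (by omega)]
  have hg' : g = (iteratedDeriv 3 f * fun t => 1 - deriv f t) * (fun t => 1 + deriv f t) +
      (iteratedDeriv 2 f * iteratedDeriv 2 f) * fun t => 3 * deriv f t := by
    funext t
    simp only [hg, Pi.add_apply, Pi.mul_apply]
    ring
  intro n hn
  have hA : ContDiff ℝ (⊤ : ℕ∞) (iteratedDeriv 3 f * fun t => 1 - deriv f t) := (hsm 3).mul hu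
  have hB : ContDiff ℝ (⊤ : ℕ∞) (iteratedDeriv 2 f * iteratedDeriv 2 f) := (hsm 2).mul (hsm 2)
  have hA0 := iteratedDeriv_mul_eq_zero_of_lt_add (a := k - 1 + (k + 1)) (b := 0) (n := n) hA hw
    (fun i => iteratedDeriv_mul_eq_zero_of_lt_add (hsm 3) hu h30 hu0) (by simp) (by omega)
  have hB0 := iteratedDeriv_mul_eq_zero_of_lt_add (a := k + k) (b := 0) (n := n) hB hc
    (fun i => iteratedDeriv_mul_eq_zero_of_lt_add (hsm 2) (hsm 2) h20 h20) (by simp) (by omega)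
  rw [hg']
  refine (iteratedDeriv_add ((hA.mul hw).of_le (hle n)).contDiffAt
    ((hB.mul hc).of_le (hle n)).contDiffAt).trans ?_
  exact (congrArg₂ (· + ·) hA0 hB0).trans (add_zero 0)
end

section
/- Let k ≥ 1 be an integer and f : ℝ → ℝ smooth with f'(0) = 1 and f^{(i)}(0) = 0 for all 2 ≤ i ≤ k+1, and let g = f'''·(1 − (f')²) + 3·f'·(f'')². Then g^{(2k)}(0) = (2k)!·(k+1)·(k+2)²·(k+3)·a_{k+2}², where a_{k+2} = f^{(k+2)}(0)/(k+2)!. In particular, if f^{(k+2)}(0) ≠ 0 (a lightlike inflection of order exactly k), then g^{(2k)}(0) ≠ 0, so the curve γ(t) = (t, f(t)) has a vertex of order exactly 2k at t = 0; i.e. LI(k) ⊆ V(2k) \ V(2k+1) and 2k is the largest integer with the inclusion property. -/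
open Filter Topology

/-- Leibniz formula at a point where one factor vanishes to order at least `m` and the other to
order at least `n`: the product vanishes to order at least `m + n`. -/
theorem iteratedDeriv_mul_eq_zero_of_lt {u v : ℝ → ℝ} {x : ℝ} {m n i : ℕ}
    (hu : ContDiff ℝ (⊤ : ℕ∞) u) (hv : ContDiff ℝ (⊤ : ℕ∞) v)
    (hum : ∀ i < m, iteratedDeriv i u x = 0) (hvn : ∀ i < n, iteratedDeriv i v x = 0)
    (hlt : i < m + n) : iteratedDeriv i (u * v) x = 0 := by
  rw [iteratedDeriv_mul (contDiff_infty.1 hu _).contDiffAt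
    (contDiff_infty.1 hv _).contDiffAt]
  refine Finset.sum_eq_zero fun j hji => ?_
  rw [Finset.mem_range] at hji
  by_cases hj : j < m
  · simp [hum j hj]
  · simp [hvn (i - j) (by omega)]

/-- At a point where the factors vanish to orders at least `m` and `n`, a single term of the
Leibniz formula for the derivative of order `m + n` survives. -/
theorem iteratedDeriv_add_mul_of_vanish {u v : ℝ → ℝ} {x : ℝ} {m n : ℕ}
    (hu : ContDiff ℝ (⊤ : ℕ∞) u) (hv : ContDiff ℝ (⊤ : ℕ∞) v)
    (hum : ∀ i < m, iteratedDeriv i u x = 0) (hvn : ∀ i < n, iteratedDeriv i v x = 0) :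
    iteratedDeriv (m + n) (u * v) x =
      ((m + n).choose m : ℝ) * iteratedDeriv m u x * iteratedDeriv n v x := by
  rw [iteratedDeriv_mul (contDiff_infty.1 hu _).contDiffAt
    (contDiff_infty.1 hv _).contDiffAt, Finset.sum_eq_single m]
  · simp
  · intro j hj hne
    rw [Finset.mem_range] at hj
    by_cases hjm : j < m
    · simp [hum j hjm]
    · simp [hvn (m + n - j) (by omega)]
  · intro h
    exact absurd (Finset.mem_range.2 (by omega)) h

theorem iteratedDeriv_iteratedDeriv (f : ℝ → ℝ) (i j : ℕ) :
    iteratedDeriv i (iteratedDeriv j f) = iteratedDeriv (i + j) f := by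
  simp only [iteratedDeriv_eq_iterate, Function.iterate_add_apply]

theorem ContDiff.iteratedDeriv_top {f : ℝ → ℝ} (hf : ContDiff ℝ (⊤ : ℕ∞) f) (j : ℕ) :
    ContDiff ℝ (⊤ : ℕ∞) (iteratedDeriv j f) := by
  rw [iteratedDeriv_eq_iterate]
  exact hf.iterate_deriv j

/-- At a lightlike inflection of order at least k, the (2k)-th derivative of the vertex
function g = f'''·(1 - (f')²) + 3·f'·(f'')² at 0 equals
(2k)!·(k+1)·(k+2)²·(k+3)·a_{k+2}² with a_{k+2} = f^{(k+2)}(0)/(k+2)!. In particular, if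
f^{(k+2)}(0) ≠ 0 then g^{(2k)}(0) ≠ 0, so LI(k) ⊆ V(2k) \ V(2k+1). -/
theorem stmt_5 (k : ℕ) (hk : 1 ≤ k) (f : ℝ → ℝ) (hf : ContDiff ℝ (⊤ : ℕ∞) f)
    (h1 : deriv f 0 = 1)
    (hi : ∀ i, 2 ≤ i → i ≤ k + 1 → iteratedDeriv i f 0 = 0)
    (g : ℝ → ℝ)
    (hg : ∀ t, g t = iteratedDeriv 3 f t * (1 - (deriv f t)^2) +
      3 * deriv f t * (iteratedDeriv 2 f t)^2) :
    iteratedDeriv (2*k) g 0 =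
      (Nat.factorial (2*k) : ℝ) * ((k:ℝ)+1) * ((k:ℝ)+2)^2 * ((k:ℝ)+3) *
        (iteratedDeriv (k+2) f 0 / (Nat.factorial (k+2) : ℝ))^2 ∧
    (iteratedDeriv (k+2) f 0 ≠ 0 → iteratedDeriv (2*k) g 0 ≠ 0) := by
  have main : iteratedDeriv (2*k) g 0 =
      (Nat.factorial (2*k) : ℝ) * ((k:ℝ)+1) * ((k:ℝ)+2)^2 * ((k:ℝ)+3) *
        (iteratedDeriv (k+2) f 0 / (Nat.factorial (k+2) : ℝ))^2 := by
    obtain ⟨j, rfl⟩ : ∃ j, k = j + 1 := ⟨k - 1, by omega⟩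
    have hD := hf.iteratedDeriv_top
    set A := iteratedDeriv (j + 1 + 2) f 0 with hA
    set p : ℝ → ℝ := fun t => 1 - iteratedDeriv 1 f t with hp
    set q : ℝ → ℝ := fun t => 1 + iteratedDeriv 1 f t with hq
    set r : ℝ → ℝ := fun t => 3 * iteratedDeriv 1 f t with hr
    have hps : ContDiff ℝ (⊤ : ℕ∞) p := contDiff_const.sub (hD 1)
    have hqs : ContDiff ℝ (⊤ : ℕ∞) q := contDiff_const.add (hD 1)
    have hrs : ContDiff ℝ (⊤ : ℕ∞) r := contDiff_const.mul (hD 1)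
    have hgeq : g = iteratedDeriv 3 f * (p * q) +
        r * (iteratedDeriv 2 f * iteratedDeriv 2 f) := by
      funext t
      simp only [hg, Pi.add_apply, Pi.mul_apply, hp, hq, hr, iteratedDeriv_one]
      ring
    have hpi : ∀ i, iteratedDeriv (i + 1) p 0 = - iteratedDeriv (i + 2) f 0 := by
      intro i
      rw [iteratedDeriv_const_sub (by omega), iteratedDeriv_neg, iteratedDeriv_iteratedDeriv]
    have hp0 : ∀ i < j + 2, iteratedDeriv i p 0 = 0 := by
      rintro (_ | i) hlt
      · simp [hp, h1]
      · rw [hpi, hi _ (by omega) (by omega), neg_zero]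
    have h20 : ∀ i < j + 1, iteratedDeriv i (iteratedDeriv 2 f) 0 = 0 := fun i hlt => by
      rw [iteratedDeriv_iteratedDeriv, hi _ (by omega) (by omega)]
    have h30 : ∀ i < j, iteratedDeriv i (iteratedDeriv 3 f) 0 = 0 := fun i hlt => by
      rw [iteratedDeriv_iteratedDeriv, hi _ (by omega) (by omega)]
    have hpq : iteratedDeriv (j + 2) (p * q) 0 = -2 * A := by
      have := iteratedDeriv_add_mul_of_vanish (n := 0) hps hqs hp0 (by simp)
      simp only [add_zero, Nat.choose_self, hpi (j + 1), iteratedDeriv_zero] at this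
      rw [this, hA]
      simp only [hq, iteratedDeriv_one, h1]
      push_cast
      ring
    have hpq0 : ∀ i < j + 2, iteratedDeriv i (p * q) 0 = 0 := fun i hlt =>
      iteratedDeriv_mul_eq_zero_of_lt (n := 0) hps hqs hp0 (by simp) hlt
    have e1 := iteratedDeriv_add_mul_of_vanish (v := p * q) (hD 3) (hps.mul hqs) h30 hpq0
    have e2 := iteratedDeriv_add_mul_of_vanish (hD 2) (hD 2) h20 h20
    have e3 := iteratedDeriv_add_mul_of_vanish (m := 0)
      (v := iteratedDeriv 2 f * iteratedDeriv 2 f) hrs ((hD 2).mul (hD 2)) (by simp)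
      fun i hlt => iteratedDeriv_mul_eq_zero_of_lt (hD 2) (hD 2) h20 h20 hlt
    have hr0 : r 0 = 3 := by simp [hr, h1]
    rw [hpq, iteratedDeriv_iteratedDeriv, show j + 3 = j + 1 + 2 by ring, ← hA,
      show j + (j + 2) = 2 * (j + 1) by ring] at e1
    rw [e2, iteratedDeriv_iteratedDeriv, ← hA, zero_add, Nat.choose_zero_right,
      iteratedDeriv_zero, hr0, show j + 1 + (j + 1) = 2 * (j + 1) by ring] at e3
    have hs1 : ContDiff ℝ (⊤ : ℕ∞) (iteratedDeriv 3 f * (p * q)) := (hD 3).mul (hps.mul hqs)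
    have hs2 : ContDiff ℝ (⊤ : ℕ∞) (r * (iteratedDeriv 2 f * iteratedDeriv 2 f)) :=
      hrs.mul ((hD 2).mul (hD 2))
    rw [hgeq, iteratedDeriv_add (contDiff_infty.1 hs1 _).contDiffAt
      (contDiff_infty.1 hs2 _).contDiffAt, e1, e3,
      Nat.cast_choose ℝ (show j ≤ 2 * (j + 1) by omega),
      Nat.cast_choose ℝ (show j + 1 ≤ 2 * (j + 1) by omega),
      show 2 * (j + 1) - j = j + 2 by omega, show 2 * (j + 1) - (j + 1) = j + 1 by omega,
      show j + 1 + 2 = j + 3 by ring]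
    have hj : (j.factorial : ℝ) ≠ 0 := by positivity
    simp only [Nat.factorial_succ j, Nat.factorial_succ (j + 1), Nat.factorial_succ (j + 2)]
    push_cast
    field_simp
    ring
  refine ⟨main, fun hne => ?_⟩
  rw [main]
  positivity
end

section
/- Let f : ℝ → ℝ be smooth with f(0) = f'(0) = f''(0) = f'''(0) = 0 and f''''(0) = 24c₄ for some c₄ ≠ 0, so that the timelike curve γ(t) = (t, f(t)) has an inflection of order 2 at t = 0. Then f''(t) ≠ 0 for all sufficiently small t ≠ 0, and the evolute e(t) = (t − f'(t)(1 − f'(t)²)/f''(t), f(t) − (1 − f'(t)²)/f''(t)) satisfies lim_{t→0} e₁(t)/t = 2/3 and lim_{t→0} t²·e₂(t) = −1/(12c₄); in particular the evolute tends to infinity asymptotically along the normal line of γ at 0 and can be modeled by x²y = 1 in suitable coordinates. -/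
open Filter Topology

/-- If `g` vanishes at `0` and `g' t / t ^ n → L` as `t → 0`, then
`g t / t ^ (n + 1) → L / (n + 1)`. -/
lemma tendsto_div_pow_succ_of_deriv {g g' : ℝ → ℝ} (hg : ∀ t, HasDerivAt g (g' t) t)
    (hg0 : g 0 = 0) {n : ℕ} {L : ℝ}
    (h : Tendsto (fun t => g' t / t ^ n) (𝓝[≠] (0:ℝ)) (𝓝 L)) :
    Tendsto (fun t => g t / t ^ (n + 1)) (𝓝[≠] (0:ℝ)) (𝓝 (L / (n + 1))) := by
  refine HasDerivAt.lhopital_zero_nhdsNE (f' := g') (g' := fun t => ((n + 1 : ℕ) : ℝ) * t ^ n)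
    (Eventually.of_forall hg)
    (Eventually.of_forall fun t => by simpa using hasDerivAt_pow (n + 1) t) ?_ ?_ ?_ ?_
  · filter_upwards [self_mem_nhdsWithin] with t ht
    have ht : t ≠ 0 := ht
    positivity
  · simpa [hg0] using (hg 0).continuousAt.tendsto.mono_left (nhdsWithin_le_nhds (s := {0}ᶜ))
  · simpa using ((continuous_pow (M := ℝ) (n + 1)).tendsto 0).mono_left
      (nhdsWithin_le_nhds (s := {0}ᶜ))
  · refine (h.div_const ((n : ℝ) + 1)).congr fun t => ?_
    push_cast
    rw [div_div, mul_comm]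

/-- At an inflection of order 2 of the timelike curve γ(t) = (t, f(t)) at t = 0, the evolute
tends to infinity along the normal line: e₁(t)/t → 2/3 and t²·e₂(t) → -1/(12c₄),
so the evolute can be modeled by x²y = 1 in suitable coordinates. -/
theorem stmt_6 (f : ℝ → ℝ) (hf : ContDiff ℝ (⊤ : ℕ∞) f) (c₄ : ℝ) (hc₄ : c₄ ≠ 0)
    (h0 : f 0 = 0) (h1 : deriv f 0 = 0) (h2 : iteratedDeriv 2 f 0 = 0)
    (h3 : iteratedDeriv 3 f 0 = 0) (h4 : iteratedDeriv 4 f 0 = 24 * c₄)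
    (e₁ e₂ : ℝ → ℝ)
    (he₁ : ∀ t, e₁ t = t - deriv f t * (1 - (deriv f t)^2) / iteratedDeriv 2 f t)
    (he₂ : ∀ t, e₂ t = f t - (1 - (deriv f t)^2) / iteratedDeriv 2 f t) :
    (∀ᶠ t in 𝓝[≠] (0:ℝ), iteratedDeriv 2 f t ≠ 0) ∧
    Tendsto (fun t => e₁ t / t) (𝓝[≠] (0:ℝ)) (𝓝 (2/3)) ∧
    Tendsto (fun t => t^2 * e₂ t) (𝓝[≠] (0:ℝ)) (𝓝 (-1/(12*c₄))) := by
  have hd (k : ℕ) (t : ℝ) : HasDerivAt (iteratedDeriv k f) (iteratedDeriv (k + 1) f t) t := by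
    rw [iteratedDeriv_succ]
    exact (hf.differentiable_iteratedDeriv k (by exact_mod_cast ENat.natCast_lt_top k) t).hasDerivAt
  have L3 : Tendsto (fun t => iteratedDeriv 3 f t / t ^ 1) (𝓝[≠] (0:ℝ)) (𝓝 (24 * c₄)) := by
    have h := (hd 3 0).tendsto_slope
    rw [h4] at h
    refine h.congr fun t => ?_
    simp [slope_def_field, h3]
  have L2 : Tendsto (fun t => iteratedDeriv 2 f t / t ^ 2) (𝓝[≠] (0:ℝ)) (𝓝 (12 * c₄)) := by
    convert tendsto_div_pow_succ_of_deriv (hd 2) h2 L3 using 2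
    push_cast
    ring
  have L1 : Tendsto (fun t => deriv f t / t ^ 3) (𝓝[≠] (0:ℝ)) (𝓝 (4 * c₄)) := by
    convert tendsto_div_pow_succ_of_deriv
      (fun t => by simpa only [iteratedDeriv_one] using hd 1 t) h1 L2 using 2
    push_cast
    ring
  have hne : ∀ᶠ t in 𝓝[≠] (0:ℝ), iteratedDeriv 2 f t ≠ 0 := by
    filter_upwards [L2.eventually_ne (mul_ne_zero (by norm_num) hc₄)] with t ht h
    simp [h] at ht
  have hid : Tendsto (fun t : ℝ => t) (𝓝[≠] (0:ℝ)) (𝓝 0) :=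
    tendsto_nhdsWithin_of_tendsto_nhds tendsto_id
  have hdf : Tendsto (deriv f) (𝓝[≠] (0:ℝ)) (𝓝 0) := by
    have h := (hd 1 0).continuousAt.tendsto.mono_left (nhdsWithin_le_nhds (s := {0}ᶜ))
    simpa only [iteratedDeriv_one, h1] using h
  have hf0 : Tendsto f (𝓝[≠] (0:ℝ)) (𝓝 0) := by
    simpa only [h0] using hf.continuous.continuousAt.tendsto.mono_left
      (nhdsWithin_le_nhds (a := (0:ℝ)) (s := {0}ᶜ))
  have hunit : Tendsto (fun t => 1 - deriv f t ^ 2) (𝓝[≠] (0:ℝ)) (𝓝 1) := by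
    simpa using (hdf.pow 2).const_sub 1
  have h12 : 12 * c₄ ≠ 0 := mul_ne_zero (by norm_num) hc₄
  refine ⟨hne, ?_, ?_⟩
  · have h := ((L1.mul hunit).div L2 h12).const_sub 1
    have hlim : 1 - 4 * c₄ * 1 / (12 * c₄) = 2 / 3 := by
      field_simp
      norm_num
    rw [hlim] at h
    refine h.congr' ?_
    filter_upwards [hne, self_mem_nhdsWithin] with t ht ht0
    have ht0 : t ≠ 0 := ht0
    simp only [he₁, Pi.div_apply]
    field_simp
  · have h := ((hid.pow 2).mul hf0).sub (hunit.div L2 h12)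
    have hlim : (0:ℝ) ^ 2 * 0 - 1 / (12 * c₄) = -1 / (12 * c₄) := by ring
    rw [hlim] at h
    refine h.congr' ?_
    filter_upwards [hne, self_mem_nhdsWithin] with t ht ht0
    have ht0 : t ≠ 0 := ht0
    simp only [he₂, Pi.div_apply]
    field_simp
end

section
/- Let f : ℝ → ℝ be smooth with f(0) = f'(0) = f''(0) = f'''(0) = f''''(0) = 0 and f^{(5)}(0) = 120c₅ for some c₅ ≠ 0, so that the timelike curve γ(t) = (t, f(t)) has an inflection of order 3 at t = 0. Then f''(t) ≠ 0 for all sufficiently small t ≠ 0, and the evolute e(t) = (t − f'(t)(1 − f'(t)²)/f''(t), f(t) − (1 − f'(t)²)/f''(t)) satisfies lim_{t→0} e₁(t)/t = 3/4 and lim_{t→0} t³·e₂(t) = −1/(20c₅); in particular the evolute tends to infinity asymptotically along the normal line of γ at 0 and can be modeled by x³y = 1 in suitable coordinates. -/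
open Filter Topology

/-- If `g 0 = 0` and `g' t / t ^ n → L` as `t → 0`, then `g t / t ^ (n + 1) → L / (n + 1)`. -/
theorem tendsto_div_pow_succ_of_hasDerivAt {g g' : ℝ → ℝ} {n : ℕ} {L : ℝ}
    (hg : ∀ t, HasDerivAt g (g' t) t) (h0 : g 0 = 0)
    (hL : Tendsto (fun t => g' t / t ^ n) (𝓝[≠] (0 : ℝ)) (𝓝 L)) :
    Tendsto (fun t => g t / t ^ (n + 1)) (𝓝[≠] (0 : ℝ)) (𝓝 (L / (n + 1))) := by
  have hn : (n + 1 : ℝ) ≠ 0 := by positivity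
  refine HasDerivAt.lhopital_zero_nhdsNE (f' := g') (g' := fun t => (n + 1 : ℝ) * t ^ n)
    (Eventually.of_forall hg) (Eventually.of_forall fun t => ?_) ?_ ?_ ?_ ?_
  · simpa using hasDerivAt_pow (n + 1) t
  · filter_upwards [self_mem_nhdsWithin] with t ht
    exact mul_ne_zero hn (pow_ne_zero n ht)
  · simpa [h0] using (hg 0).continuousAt.continuousWithinAt.tendsto (s := {0}ᶜ)
  · have h : ContinuousWithinAt (fun t : ℝ => t ^ (n + 1)) {0}ᶜ 0 := by fun_prop
    simpa using h.tendsto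
  · refine (hL.div_const (n + 1 : ℝ)).congr fun t => ?_
    rw [div_div, mul_comm]

/-- At an inflection of order 3 of the timelike curve γ(t) = (t, f(t)) at t = 0, the evolute
tends to infinity along the normal line: e₁(t)/t → 3/4 and t³·e₂(t) → -1/(20c₅),
so the evolute can be modeled by x³y = 1 in suitable coordinates. -/
theorem stmt_7 (f : ℝ → ℝ) (hf : ContDiff ℝ (⊤ : ℕ∞) f) (c₅ : ℝ) (hc₅ : c₅ ≠ 0)
    (h0 : f 0 = 0) (h1 : deriv f 0 = 0) (h2 : iteratedDeriv 2 f 0 = 0)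
    (h3 : iteratedDeriv 3 f 0 = 0) (h4 : iteratedDeriv 4 f 0 = 0)
    (h5 : iteratedDeriv 5 f 0 = 120 * c₅)
    (e₁ e₂ : ℝ → ℝ)
    (he₁ : ∀ t, e₁ t = t - deriv f t * (1 - (deriv f t)^2) / iteratedDeriv 2 f t)
    (he₂ : ∀ t, e₂ t = f t - (1 - (deriv f t)^2) / iteratedDeriv 2 f t) :
    (∀ᶠ t in 𝓝[≠] (0:ℝ), iteratedDeriv 2 f t ≠ 0) ∧
    Tendsto (fun t => e₁ t / t) (𝓝[≠] (0:ℝ)) (𝓝 (3/4)) ∧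
    Tendsto (fun t => t^3 * e₂ t) (𝓝[≠] (0:ℝ)) (𝓝 (-1/(20*c₅))) := by
  have hD (k : ℕ) (t : ℝ) :
      HasDerivAt (iteratedDeriv k f) (iteratedDeriv (k + 1) f t) t := by
    rw [iteratedDeriv_succ]
    exact (hf.differentiable_iteratedDeriv k (by exact_mod_cast ENat.natCast_lt_top k) t).hasDerivAt
  have l5 : Tendsto (fun t => iteratedDeriv 5 f t / t ^ 0) (𝓝[≠] (0 : ℝ)) (𝓝 (120 * c₅)) := by
    simpa [h5] using (hD 5 0).continuousAt.continuousWithinAt.tendsto (s := {0}ᶜ)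
  have l4 := tendsto_div_pow_succ_of_hasDerivAt (hD 4) h4 l5
  have l3 := tendsto_div_pow_succ_of_hasDerivAt (hD 3) h3 l4
  have l2 := tendsto_div_pow_succ_of_hasDerivAt (hD 2) h2 l3
  have l1 := tendsto_div_pow_succ_of_hasDerivAt (hD 1) (by simpa using h1) l2
  have e2 : 120 * c₅ / ((0 : ℕ) + 1) / ((0 + 1 : ℕ) + 1) / ((0 + 1 + 1 : ℕ) + 1) = 20 * c₅ := by
    push_cast; ring
  have e1 : 20 * c₅ / ((0 + 1 + 1 + 1 : ℕ) + 1) = 5 * c₅ := by push_cast; ring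
  rw [e2] at l2 l1
  rw [e1] at l1
  simp only [iteratedDeriv_one, zero_add, Nat.reduceAdd] at l1 l2
  have h20 : 20 * c₅ ≠ 0 := by positivity
  have hne : ∀ᶠ t in 𝓝[≠] (0 : ℝ), iteratedDeriv 2 f t ≠ 0 := by
    filter_upwards [l2.eventually_ne h20] with t ht h
    simp [h] at ht
  have hf0 : Tendsto f (𝓝[≠] (0 : ℝ)) (𝓝 0) := by
    simpa [h0] using hf.continuous.continuousAt.continuousWithinAt.tendsto (x := 0) (s := {0}ᶜ)
  have hf1 : Tendsto (deriv f) (𝓝[≠] (0 : ℝ)) (𝓝 0) := by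
    simpa [h1] using (hD 1 0).continuousAt.continuousWithinAt.tendsto (s := {0}ᶜ)
  have ht0 : Tendsto (fun t : ℝ => t) (𝓝[≠] (0 : ℝ)) (𝓝 0) := tendsto_id.mono_left inf_le_left
  have hq : Tendsto (fun t => 1 - deriv f t ^ 2) (𝓝[≠] (0 : ℝ)) (𝓝 1) := by
    simpa using (hf1.pow 2).const_sub 1
  refine ⟨hne, ?_, ?_⟩
  · have h := ((l1.div l2 h20).mul hq).const_sub 1
    have hval : 1 - 5 * c₅ / (20 * c₅) * 1 = 3 / 4 := by field_simp; norm_num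
    rw [hval] at h
    refine h.congr' ?_
    filter_upwards [hne, self_mem_nhdsWithin] with t ht (ht' : t ≠ 0)
    simp only [Pi.div_apply, he₁]
    field_simp
  · have h := ((ht0.pow 3).mul hf0).sub (hq.div l2 h20)
    have hval : (0 : ℝ) ^ 3 * 0 - 1 / (20 * c₅) = -1 / (20 * c₅) := by ring
    rw [hval] at h
    refine h.congr' ?_
    filter_upwards [hne, self_mem_nhdsWithin] with t ht (ht' : t ≠ 0)
    simp only [Pi.div_apply, he₂]
    field_simp
end

section
/- Consider the model family α_u(t) = (t, t⁴ + u·t²) of deformations of an inflection of order 2, and let κ_u denote the Minkowski curvature of α_u. There exist ε, δ > 0 such that for every u with 0 < |u| < δ: (i) α_u is timelike on (−ε, ε); (ii) the zeros of κ_u in (−ε, ε) are exactly t = ±√(−u/6) if u < 0 and there are none if u > 0, and at these zeros κ_u' ≠ 0 (they are ordinary inflections); (iii) the unique zero of κ_u' in (−ε, ε) is t = 0 (a single vertex); (iv) κ_u(0)·κ_u''(0) < 0 if u < 0 (an outward vertex) and κ_u(0)·κ_u''(0) > 0 if u > 0 (an inward vertex). -/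
open Filter Topology

/-- The slope `4t³ + 2ut` of the model curve `t ↦ t⁴ + ut²`. -/
def modelSlope (u t : ℝ) : ℝ := 4 * t ^ 3 + 2 * u * t

/-- The cofactor of `t` in the derivative of the Minkowski curvature, up to a positive factor. -/
def vertexCofactor (u t : ℝ) : ℝ :=
  24 * (1 - modelSlope u t ^ 2) + 3 * (4 * t ^ 2 + 2 * u) * (12 * t ^ 2 + 2 * u) ^ 2

/-- The Minkowski curvature of the model curve `t ↦ (t, t⁴ + ut²)`. -/
noncomputable def modelCurvature (u t : ℝ) : ℝ :=
  (12 * t ^ 2 + 2 * u) / (1 - modelSlope u t ^ 2) ^ ((3 : ℝ) / 2)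

/-- The quotient of the derivative of the Minkowski curvature by `t`. -/
noncomputable def curvatureDerivCofactor (u t : ℝ) : ℝ :=
  vertexCofactor u t *
    ((1 - modelSlope u t ^ 2) ^ ((1 : ℝ) / 2) /
      ((1 - modelSlope u t ^ 2) ^ ((3 : ℝ) / 2)) ^ 2)

theorem deriv_model (u : ℝ) : deriv (fun t : ℝ => t ^ 4 + u * t ^ 2) = modelSlope u := by
  funext t
  have h := (hasDerivAt_pow 4 t).add ((hasDerivAt_pow 2 t).const_mul u)
  refine h.deriv.trans ?_
  norm_num [modelSlope]
  ring

theorem hasDerivAt_modelSlope (u t : ℝ) :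
    HasDerivAt (modelSlope u) (12 * t ^ 2 + 2 * u) t := by
  have h := ((hasDerivAt_pow 3 t).const_mul 4).add ((hasDerivAt_id t).const_mul (2 * u))
  refine h.congr_deriv ?_
  norm_num
  ring

theorem iteratedDeriv_two_model (u t : ℝ) :
    iteratedDeriv 2 (fun t : ℝ => t ^ 4 + u * t ^ 2) t = 12 * t ^ 2 + 2 * u := by
  rw [iteratedDeriv_succ, iteratedDeriv_one, deriv_model]
  exact (hasDerivAt_modelSlope u t).deriv

theorem modelSlope_sq_lt {u t : ℝ} (hu : |u| < 1 / 4) (ht : |t| < 1 / 4) :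
    modelSlope u t ^ 2 < 1 / 16 := by
  have h2 : t ^ 2 < 1 / 16 := by nlinarith [sq_abs t, abs_nonneg t]
  have h : |modelSlope u t| < 1 / 4 := by
    have h3 : modelSlope u t = t * (4 * t ^ 2 + 2 * u) := by unfold modelSlope; ring
    have h4 : |4 * t ^ 2 + 2 * u| < 1 := by
      rw [abs_lt] at hu ⊢
      constructor <;> nlinarith
    rw [h3, abs_mul]
    nlinarith [abs_nonneg t]
  nlinarith [sq_abs (modelSlope u t), abs_nonneg (modelSlope u t)]

theorem vertexCofactor_pos {u t : ℝ} (hu : |u| < 1 / 4) (ht : |t| < 1 / 4) :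
    0 < vertexCofactor u t := by
  have h2 : t ^ 2 < 1 / 16 := by nlinarith [sq_abs t, abs_nonneg t]
  have hs := modelSlope_sq_lt hu ht
  rw [abs_lt] at hu
  have h4 : (12 * t ^ 2 + 2 * u) ^ 2 < 4 := by
    nlinarith [sq_nonneg t]
  unfold vertexCofactor
  nlinarith [sq_nonneg t, sq_nonneg (12 * t ^ 2 + 2 * u)]

theorem curvatureDerivCofactor_pos {u t : ℝ} (hu : |u| < 1 / 4) (ht : |t| < 1 / 4) :
    0 < curvatureDerivCofactor u t := by
  have hG := vertexCofactor_pos hu ht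
  have hw : 0 < 1 - modelSlope u t ^ 2 := by linarith [modelSlope_sq_lt hu ht]
  unfold curvatureDerivCofactor
  positivity

theorem hasDerivAt_modelCurvature {u t : ℝ} (hw : 0 < 1 - modelSlope u t ^ 2) :
    HasDerivAt (modelCurvature u) (t * curvatureDerivCofactor u t) t := by
  have h1 : HasDerivAt (fun t : ℝ => 12 * t ^ 2 + 2 * u) (24 * t) t := by
    refine (((hasDerivAt_pow 2 t).const_mul 12).add_const (2 * u)).congr_deriv ?_
    norm_num
    ring
  have h2 := (((hasDerivAt_modelSlope u t).pow 2).const_sub 1).rpow_const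
    (p := (3 : ℝ) / 2) (Or.inl hw.ne')
  refine (h1.div h2 (Real.rpow_pos_of_pos hw _).ne').congr_deriv ?_
  have e1 : (1 - modelSlope u t ^ 2) ^ ((3 : ℝ) / 2) =
      (1 - modelSlope u t ^ 2) * (1 - modelSlope u t ^ 2) ^ ((1 : ℝ) / 2) := by
    rw [← Real.rpow_one_add' hw.le (by norm_num)]
    norm_num
  have e2 : (3 : ℝ) / 2 - 1 = 1 / 2 := by norm_num
  simp only [Pi.pow_apply]
  rw [curvatureDerivCofactor, e2, ← mul_assoc, ← mul_div_assoc]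
  rw [e1]
  simp only [vertexCofactor, modelSlope]
  push_cast
  ring

theorem deriv_modelCurvature {u t : ℝ} (hu : |u| < 1 / 4) (ht : |t| < 1 / 4) :
    deriv (modelCurvature u) t = t * curvatureDerivCofactor u t :=
  (hasDerivAt_modelCurvature (by linarith [modelSlope_sq_lt hu ht])).deriv

theorem iteratedDeriv_two_modelCurvature_zero {u : ℝ} (hu : |u| < 1 / 4) :
    iteratedDeriv 2 (modelCurvature u) 0 = curvatureDerivCofactor u 0 := by
  have hd : deriv (modelCurvature u) =ᶠ[𝓝 0] fun t => t * curvatureDerivCofactor u t := by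
    filter_upwards [Metric.ball_mem_nhds (0 : ℝ) (by norm_num : (0 : ℝ) < 1 / 4)] with t ht
    exact deriv_modelCurvature hu (by simpa using ht)
  have hw : 1 - modelSlope u 0 ^ 2 ≠ 0 := by simp [modelSlope]
  have hp := (hasDerivAt_modelSlope u 0).differentiableAt
  have hc : DifferentiableAt ℝ (curvatureDerivCofactor u) 0 := by
    have hb : DifferentiableAt ℝ (fun t => 1 - modelSlope u t ^ 2) 0 :=
      (hp.pow 2).const_sub 1
    have hv : DifferentiableAt ℝ (vertexCofactor u) 0 := by
      unfold vertexCofactor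
      fun_prop
    refine hv.mul ((hb.rpow_const (Or.inl hw)).div ((hb.rpow_const (Or.inl hw)).pow 2) ?_)
    simp [modelSlope]
  rw [iteratedDeriv_succ, iteratedDeriv_one, hd.deriv_eq]
  exact ((hasDerivAt_id (0 : ℝ)).mul hc.hasDerivAt).deriv.trans (by simp)

theorem modelCurvature_eq_zero_iff {u t : ℝ} (hw : 0 < 1 - modelSlope u t ^ 2) :
    modelCurvature u t = 0 ↔ 12 * t ^ 2 + 2 * u = 0 := by
  rw [modelCurvature, div_eq_zero_iff, or_iff_left (Real.rpow_pos_of_pos hw _).ne']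

/-- Behavior of the model family α_u(t) = (t, t⁴ + u·t²) of deformations of an inflection of
order 2: for small u ≠ 0 the curve is timelike near 0; for u < 0 there are exactly two
ordinary inflections t = ±√(-u/6) and an outward vertex at t = 0; for u > 0 there are no
inflections and an inward vertex at t = 0. -/
theorem stmt_8 (f : ℝ → ℝ → ℝ) (hf : ∀ u t, f u t = t^4 + u * t^2)
    (κ : ℝ → ℝ → ℝ)
    (hκ : ∀ u t, κ u t =
      iteratedDeriv 2 (f u) t / (1 - (deriv (f u) t)^2) ^ ((3:ℝ)/2)) :
    ∃ ε > 0, ∃ δ > 0, ∀ u : ℝ, 0 < |u| → |u| < δ →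
      ((∀ t, |t| < ε → (deriv (f u) t)^2 < 1) ∧
       (∀ t, |t| < ε → (κ u t = 0 ↔
          u < 0 ∧ (t = Real.sqrt (-u/6) ∨ t = -Real.sqrt (-u/6)))) ∧
       (∀ t, |t| < ε → κ u t = 0 → deriv (κ u) t ≠ 0) ∧
       (∀ t, |t| < ε → (deriv (κ u) t = 0 ↔ t = 0)) ∧
       (u < 0 → κ u 0 * iteratedDeriv 2 (κ u) 0 < 0) ∧
       (0 < u → 0 < κ u 0 * iteratedDeriv 2 (κ u) 0)) := by
  obtain rfl : f = fun u t => t ^ 4 + u * t ^ 2 := by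
    funext u t
    exact hf u t
  obtain rfl : κ = modelCurvature := by
    funext u t
    rw [hκ, iteratedDeriv_two_model, deriv_model, modelCurvature]
  refine ⟨1 / 4, by norm_num, 1 / 4, by norm_num, fun u hu0 hu => ?_⟩
  have hu0 : u ≠ 0 := abs_pos.mp hu0
  have hw : ∀ t, |t| < 1 / 4 → 0 < 1 - modelSlope u t ^ 2 := fun t ht => by
    linarith [modelSlope_sq_lt hu ht]
  have h0 : |(0 : ℝ)| < 1 / 4 := by norm_num
  have hvertex : ∀ t, |t| < 1 / 4 → (deriv (modelCurvature u) t = 0 ↔ t = 0) := fun t ht => by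
    rw [deriv_modelCurvature hu ht, mul_eq_zero,
      or_iff_left (curvatureDerivCofactor_pos hu ht).ne']
  have hpos := curvatureDerivCofactor_pos hu h0
  have hval : modelCurvature u 0 = 2 * u := by simp [modelCurvature, modelSlope]
  refine ⟨fun t ht => ?_, fun t ht => ?_, fun t ht hz => ?_, hvertex, fun h => ?_, fun h => ?_⟩
  · rw [deriv_model]
    linarith [hw t ht]
  · rw [modelCurvature_eq_zero_iff (hw t ht)]
    constructor
    · intro h
      have hneg : u < 0 := lt_of_le_of_ne (by nlinarith [sq_nonneg t]) hu0
      refine ⟨hneg, sq_eq_sq_iff_eq_or_eq_neg.mp ?_⟩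
      rw [Real.sq_sqrt (by linarith)]
      linarith
    · rintro ⟨hneg, h⟩
      have h2 := sq_eq_sq_iff_eq_or_eq_neg.mpr h
      rw [Real.sq_sqrt (by linarith)] at h2
      linarith
  · rw [Ne, hvertex t ht]
    rintro rfl
    rw [hval] at hz
    exact hu0 (by linarith)
  · rw [iteratedDeriv_two_modelCurvature_zero hu, hval]
    exact mul_neg_of_neg_of_pos (by linarith) hpos
  · rw [iteratedDeriv_two_modelCurvature_zero hu, hval]
    exact mul_pos (by linarith) hpos
end

section
/- Let β : ℝ → ℝ be smooth with β(0) = β'(0) = β''(0) = 0 and let γ(t) = (t², β(t)) (a curve with a singular point at t = 0 whose limiting tangent is the timelike direction (1,0)). For u = (u₁,u₂) ∈ ℝ² let d_u(t) = −(t² − u₁)² + (β(t) − u₂)². Then d_u'(0) = 0 for every u, and d_u''(0) = 4u₁; consequently {u ∈ ℝ² : d_u'(0) = d_u''(0) = 0} = {u ∈ ℝ² : u₁ = 0}, so the limiting normal line u₁ = 0 of γ at the singular point is contained in the caustic Bif(d) of γ. -/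
open Filter Topology

/-- For γ(t) = (t², β(t)) with β vanishing to second order at 0 (singular point with timelike
limiting tangent (1,0)), the distance squared family d_u(t) = -(t²-u₁)² + (β(t)-u₂)²
satisfies d_u'(0) = 0 and d_u''(0) = 4u₁; hence the limiting normal line u₁ = 0 is
contained in the caustic of γ. -/
theorem stmt_10 (β : ℝ → ℝ) (hβ : ContDiff ℝ (⊤ : ℕ∞) β)
    (h0 : β 0 = 0) (h1 : deriv β 0 = 0) (h2 : iteratedDeriv 2 β 0 = 0)
    (d : ℝ × ℝ → ℝ → ℝ)
    (hd : ∀ u t, d u t = -(t^2 - u.1)^2 + (β t - u.2)^2) :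
    (∀ u : ℝ × ℝ, deriv (d u) 0 = 0 ∧ iteratedDeriv 2 (d u) 0 = 4 * u.1) ∧
    {u : ℝ × ℝ | deriv (d u) 0 = 0 ∧ iteratedDeriv 2 (d u) 0 = 0} =
      {u : ℝ × ℝ | u.1 = 0} := by
  have key : ∀ u : ℝ × ℝ, deriv (d u) 0 = 0 ∧ iteratedDeriv 2 (d u) 0 = 4 * u.1 := by
    intro u
    have hβ' (t : ℝ) : HasDerivAt β (deriv β t) t :=
      (hβ.differentiable (by simp) t).hasDerivAt
    have hβ'' : HasDerivAt (deriv β) 0 0 := by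
      have hdiff : Differentiable ℝ (deriv β) :=
        (contDiff_infty_iff_deriv.1 hβ).2.differentiable (by simp)
      have h := (hdiff 0).hasDerivAt
      rwa [← iteratedDeriv_one, ← iteratedDeriv_succ, h2, iteratedDeriv_one] at h
    have hderiv : deriv (d u) =
        fun t => -(4 * t * (t ^ 2 - u.1)) + 2 * (β t - u.2) * deriv β t := by
      funext t
      rw [show d u = fun t => -(t ^ 2 - u.1) ^ 2 + (β t - u.2) ^ 2 from funext (hd u)]
      have h := ((((hasDerivAt_pow 2 t).sub_const u.1).fun_pow 2).fun_neg).fun_add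
        (((hβ' t).sub_const u.2).fun_pow 2)
      rw [h.deriv]
      push_cast
      ring
    refine ⟨by simp [hderiv, h1], ?_⟩
    rw [iteratedDeriv_succ, iteratedDeriv_one, hderiv]
    have h := ((((hasDerivAt_id' (0 : ℝ)).const_mul 4).fun_mul
      ((hasDerivAt_pow 2 (0 : ℝ)).sub_const u.1)).fun_neg).fun_add
      ((((hβ' 0).sub_const u.2).const_mul 2).fun_mul hβ'')
    rw [h.deriv, h1]
    simp
  refine ⟨key, ?_⟩
  ext u
  simp [key u]
end

section
/- Let β : ℝ → ℝ be smooth, let γ(t) = (t², β(t)), and for u = (u₁,u₂) ∈ ℝ² let d_u(t) = −(t² − u₁)² + (β(t) − u₂)². Fix t ∈ ℝ with β'(t) − t·β''(t) ≠ 0. Then there is a unique u ∈ ℝ² with d_u'(t) = d_u''(t) = 0, given by u₂ = β(t) − (t·β'(t)² − 4t³)/(β'(t) − t·β''(t)) and u₁ = 3t² − (β''(t)·(β(t) − u₂) + β'(t)²)/2. -/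
open Filter Topology

/-- The first derivative of the distance squared function of `(s², β s)` from `(a, b)`. -/
lemma hasDerivAt_distSq {β : ℝ → ℝ} {s β' : ℝ} (hβ : HasDerivAt β β' s) (a b : ℝ) :
    HasDerivAt (fun r => -(r ^ 2 - a) ^ 2 + (β r - b) ^ 2)
      (-4 * s * (s ^ 2 - a) + 2 * β' * (β s - b)) s := by
  refine (((((hasDerivAt_id' s).pow 2).sub_const a).pow 2).neg.add
    ((hβ.sub_const b).pow 2)).congr_deriv ?_
  norm_num
  ring

/-- The second derivative of the distance squared function of `(s², β s)` from `(a, b)`. -/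
lemma hasDerivAt_deriv_distSq {β β' : ℝ → ℝ} {s β'' : ℝ} (hβ : HasDerivAt β (β' s) s)
    (hβ' : HasDerivAt β' β'' s) (a b : ℝ) :
    HasDerivAt (fun r => -4 * r * (r ^ 2 - a) + 2 * β' r * (β r - b))
      (-12 * s ^ 2 + 4 * a + 2 * β'' * (β s - b) + 2 * β' s ^ 2) s := by
  refine ((((hasDerivAt_id' s).const_mul (-4)).mul
    (((hasDerivAt_id' s).pow 2).sub_const a)).add
    ((hβ'.const_mul 2).mul (hβ.sub_const b))).congr_deriv ?_
  norm_num
  ring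

/-- For γ(t) = (t², β(t)) and a parameter t with β'(t) - tβ''(t) ≠ 0, there is a unique
u ∈ ℝ² with d_u'(t) = d_u''(t) = 0, given by the stated formulas; this computes the
non-linear branch of the caustic. -/
theorem stmt_11 (β : ℝ → ℝ) (hβ : ContDiff ℝ (⊤ : ℕ∞) β)
    (d : ℝ × ℝ → ℝ → ℝ)
    (hd : ∀ u t, d u t = -(t^2 - u.1)^2 + (β t - u.2)^2)
    (t : ℝ) (ht : deriv β t - t * iteratedDeriv 2 β t ≠ 0) :
    ∀ u : ℝ × ℝ,
      (deriv (d u) t = 0 ∧ iteratedDeriv 2 (d u) t = 0) ↔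
      (u.2 = β t - (t * (deriv β t)^2 - 4*t^3) /
          (deriv β t - t * iteratedDeriv 2 β t) ∧
       u.1 = 3*t^2 -
          (iteratedDeriv 2 β t * (β t - u.2) + (deriv β t)^2) / 2) := by
  intro u
  have h₁ (s : ℝ) : HasDerivAt β (deriv β s) s :=
    (hβ.differentiable (by simp)).differentiableAt.hasDerivAt
  have h₂ : HasDerivAt (deriv β) (iteratedDeriv 2 β t) t := by
    rw [iteratedDeriv_succ, iteratedDeriv_one]
    have h : ContDiff ℝ 1 (deriv β) := (contDiff_succ_iff_deriv (n := 1)).1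
      (contDiff_infty.1 hβ 2) |>.2.2
    exact (h.differentiable one_ne_zero).differentiableAt.hasDerivAt
  have hdu : d u = fun s => -(s ^ 2 - u.1) ^ 2 + (β s - u.2) ^ 2 := funext (hd u)
  have hd₁ : deriv (d u) = fun s => -4 * s * (s ^ 2 - u.1) + 2 * deriv β s * (β s - u.2) := by
    rw [hdu]
    exact funext fun s => (hasDerivAt_distSq (h₁ s) u.1 u.2).deriv
  have hd₂ : iteratedDeriv 2 (d u) t = -12 * t ^ 2 + 4 * u.1
      + 2 * iteratedDeriv 2 β t * (β t - u.2) + 2 * deriv β t ^ 2 := by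
    rw [iteratedDeriv_succ, iteratedDeriv_one, hd₁]
    exact (hasDerivAt_deriv_distSq (h₁ t) h₂ u.1 u.2).deriv
  rw [hd₂, hd₁, eq_sub_iff_add_eq (a := u.2), ← eq_sub_iff_add_eq' (c := u.2), div_eq_iff ht]
  constructor
  · rintro ⟨e₁, e₂⟩
    constructor
    · linear_combination -e₁ / 2 + t * e₂ / 2
    · linear_combination e₂ / 4
  · rintro ⟨e₁, e₂⟩
    constructor
    · linear_combination -2 * e₁ + 4 * t * e₂
    · linear_combination 4 * e₂
end

section
/- Let β : ℝ → ℝ be smooth with β(0) = β'(0) = β''(0) = 0 and β'''(0) = 6c₃ for some c₃ ≠ 0, so that γ(t) = (t², β(t)) has a non-lightlike ordinary cusp at t = 0. Then β'(t) − t·β''(t) ≠ 0 for all sufficiently small t ≠ 0, and the branch u(t) = (u₁(t), u₂(t)) of the caustic of γ given by u₂(t) = β(t) − (t·β'(t)² − 4t³)/(β'(t) − t·β''(t)) and u₁(t) = 3t² − (β''(t)·(β(t) − u₂(t)) + β'(t)²)/2 satisfies lim_{t→0} u₁(t)/t² = −1 and lim_{t→0} u₂(t)/t = −4/(3c₃);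 in particular this branch is a regular curve through the cusp point with ordinary tangency with the limiting normal line u₁ = 0 of γ, lying in the half-plane u₁ < 0 not containing the curve. -/
open Filter Topology

/-- At a non-lightlike ordinary cusp γ(t) = (t², β(t)) (β vanishing to order 2, β'''(0) = 6c₃
with c₃ ≠ 0), the non-linear branch of the caustic satisfies u₁(t)/t² → -1 and
u₂(t)/t → -4/(3c₃): it is a regular curve through the cusp point with ordinary tangency
with the limiting normal line u₁ = 0, on the side u₁ < 0 not containing the curve. -/
theorem stmt_12 (β : ℝ → ℝ) (hβ : ContDiff ℝ (⊤ : ℕ∞) β) (c₃ : ℝ) (hc₃ : c₃ ≠ 0)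
    (h0 : β 0 = 0) (h1 : deriv β 0 = 0) (h2 : iteratedDeriv 2 β 0 = 0)
    (h3 : iteratedDeriv 3 β 0 = 6 * c₃)
    (u₁ u₂ : ℝ → ℝ)
    (hu₂ : ∀ t, u₂ t = β t - (t * (deriv β t)^2 - 4*t^3) /
        (deriv β t - t * iteratedDeriv 2 β t))
    (hu₁ : ∀ t, u₁ t = 3*t^2 -
        (iteratedDeriv 2 β t * (β t - u₂ t) + (deriv β t)^2) / 2) :
    (∀ᶠ t in 𝓝[≠] (0:ℝ), deriv β t - t * iteratedDeriv 2 β t ≠ 0) ∧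
    Tendsto (fun t => u₁ t / t^2) (𝓝[≠] (0:ℝ)) (𝓝 (-1)) ∧
    Tendsto (fun t => u₂ t / t) (𝓝[≠] (0:ℝ)) (𝓝 (-4/(3*c₃))) := by
  have hd1 : ∀ t, HasDerivAt β (deriv β t) t := fun t =>
    (hβ.differentiable (by simp) t).hasDerivAt
  have hd2 : ∀ t, HasDerivAt (deriv β) (iteratedDeriv 2 β t) t := fun t => by
    have h := (hβ.differentiable_iteratedDeriv 1
      (WithTop.coe_lt_coe.2 (ENat.natCast_lt_top 1)) t).hasDerivAt
    rwa [← iteratedDeriv_succ, iteratedDeriv_one] at h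
  have hd3 : HasDerivAt (iteratedDeriv 2 β) (6 * c₃) 0 := by
    have h := (hβ.differentiable_iteratedDeriv 2
      (WithTop.coe_lt_coe.2 (ENat.natCast_lt_top 2)) 0).hasDerivAt
    rwa [← iteratedDeriv_succ, h3] at h
  have hne : ∀ᶠ t in 𝓝[≠] (0 : ℝ), t ≠ 0 := eventually_mem_nhdsWithin
  have ht : Tendsto (fun t : ℝ => t) (𝓝[≠] 0) (𝓝 0) := tendsto_id.mono_left nhdsWithin_le_nhds
  have hb : Tendsto (fun t => β t / t) (𝓝[≠] 0) (𝓝 0) := by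
    have h := (hd1 0).tendsto_slope
    simpa [slope_fun_def_field, h0, h1] using h
  have hq : Tendsto (fun t => iteratedDeriv 2 β t / t) (𝓝[≠] 0) (𝓝 (6 * c₃)) := by
    have h := hd3.tendsto_slope
    simpa [slope_fun_def_field, h2] using h
  have hp : Tendsto (fun t => deriv β t / t ^ 2) (𝓝[≠] 0) (𝓝 (3 * c₃)) := by
    refine HasDerivAt.lhopital_zero_nhdsNE (f' := iteratedDeriv 2 β) (g' := fun t => 2 * t)
      (Eventually.of_forall hd2) (Eventually.of_forall fun t => ?_) ?_ ?_ ?_ ?_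
    · simpa using hasDerivAt_pow 2 t
    · filter_upwards [hne] with t h using mul_ne_zero two_ne_zero h
    · simpa [h1] using (hd2 0).continuousAt.tendsto.mono_left nhdsWithin_le_nhds
    · simpa using ht.pow 2
    · convert hq.div_const 2 using 2
      · rw [div_div, mul_comm]
      · ring
  have hpq : Tendsto (fun t => deriv β t / t ^ 2 - iteratedDeriv 2 β t / t) (𝓝[≠] 0)
      (𝓝 (-(3 * c₃))) := by
    convert hp.sub hq using 2
    ring
  have hlim : -(3 * c₃) ≠ 0 := by simpa using hc₃
  have hD : ∀ᶠ t in 𝓝[≠] (0 : ℝ), deriv β t - t * iteratedDeriv 2 β t ≠ 0 := by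
    filter_upwards [hne, hpq.eventually_ne hlim] with t h hn hz
    apply hn
    field_simp
    simpa using hz
  have htp : Tendsto (fun t => t ^ 2 * (deriv β t / t ^ 2) ^ 2) (𝓝[≠] 0) (𝓝 0) := by
    simpa using (ht.pow 2).mul (hp.pow 2)
  have hu₂lim : Tendsto (fun t => u₂ t / t) (𝓝[≠] 0) (𝓝 (-4 / (3 * c₃))) := by
    have h := hb.sub ((htp.sub_const 4).div hpq hlim)
    have hval : 0 - (0 - 4) / -(3 * c₃) = -4 / (3 * c₃) := by
      field_simp
      norm_num
    rw [hval] at h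
    refine h.congr' ?_
    filter_upwards [hne, hD] with t h hn
    have hquot : deriv β t / t ^ 2 - iteratedDeriv 2 β t / t =
        (deriv β t - t * iteratedDeriv 2 β t) / t ^ 2 := by
      field_simp
    simp only [Pi.div_apply]
    rw [hu₂, hquot]
    field_simp
  refine ⟨hD, ?_, hu₂lim⟩
  have h := ((hq.mul (hb.sub hu₂lim)).add htp).div_const 2 |>.const_sub 3
  have hval : 3 - (6 * c₃ * (0 - -4 / (3 * c₃)) + 0) / 2 = -1 := by
    field_simp
    norm_num
  rw [hval] at h
  refine h.congr' ?_
  filter_upwards [hne] with t h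
  rw [hu₁]
  field_simp
end

section
/- Consider the model family α_u(t) = (t², u·t + t³) of deformations of a non-lightlike ordinary cusp, with β_u(t) = ut + t³. There exist ε, δ > 0 such that for every u with 0 < |u| < δ: (i) there exist t₁ ≠ t₂ in (−ε, ε) with α_u(t₁) = α_u(t₂) if and only if u < 0, in which case necessarily {t₁, t₂} = {√(−u), −√(−u)} (a unique self-intersection point, present exactly for u < 0); (ii) the zeros in (−ε, ε) of the inflection function ⟨α_u''(t), α_u'(t)^⊥⟩ = −2u + 6t² are exactly t = ±√(u/3) if u > 0, and there are none if u < 0; (iii) the lightlike points of α_u in (−ε, ε), i.e. solutions of β_u'(t) = ±2t, are exactly t = (1 − √(1 − 3u))/3 and t = (−1 + √(1 − 3u))/3; (iv) if u < 0 then both lightlike parameters lie strictly between −√(−u) and √(−u), i.e. the lightlike points are between the self-intersection points. -/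
open Filter Topology

theorem eq_neg_and_sq_of_cusp_deformation_self_intersection {u a b : ℝ} (hne : a ≠ b)
    (h₁ : a ^ 2 = b ^ 2) (h₂ : u * a + a ^ 3 = u * b + b ^ 3) : b = -a ∧ a ^ 2 = -u := by
  have hba : b = -a := by
    rcases sq_eq_sq_iff_eq_or_eq_neg.mp h₁ with h | h
    · exact absurd h hne
    · linarith
  subst hba
  have ha : a ≠ 0 := by
    rintro rfl
    simp at hne
  refine ⟨rfl, mul_left_cancel₀ ha ?_⟩
  linarith

theorem eq_sqrt_or_eq_neg_sqrt_of_sq_eq {a x : ℝ} (h : a ^ 2 = x) :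
    a = Real.sqrt x ∨ a = -Real.sqrt x := by
  rw [← h, Real.sqrt_sq_eq_abs]
  exact eq_or_eq_neg_of_abs_eq rfl

theorem deriv_mul_add_cube (u t : ℝ) : deriv (fun t : ℝ => u * t + t ^ 3) t = u + 3 * t ^ 2 := by
  have h := ((hasDerivAt_id' t).const_mul u).add (hasDerivAt_pow 3 t)
  refine (h.congr_deriv ?_).deriv
  norm_num

/-- Behavior of the model family α_u(t) = (t², ut + t³) of deformations of a non-lightlike
ordinary cusp: for small u ≠ 0 there is a self-intersection iff u < 0, with parameters
±√(-u); the inflections (zeros of -2u + 6t²) are exactly t = ±√(u/3) for u > 0 and absent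
for u < 0; the lightlike parameters are exactly t = (1-√(1-3u))/3 and t = (-1+√(1-3u))/3;
and for u < 0 both lightlike parameters lie strictly between the self-intersection
parameters -√(-u) and √(-u). -/
theorem stmt_14 (β : ℝ → ℝ → ℝ) (hβ : ∀ u t, β u t = u*t + t^3)
    (α : ℝ → ℝ → ℝ × ℝ) (hα : ∀ u t, α u t = (t^2, β u t)) :
    ∃ ε > 0, ∃ δ > 0, ∀ u : ℝ, 0 < |u| → |u| < δ →
      (((∃ t₁ t₂ : ℝ, |t₁| < ε ∧ |t₂| < ε ∧ t₁ ≠ t₂ ∧ α u t₁ = α u t₂) ↔ u < 0) ∧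
       (∀ t₁ t₂ : ℝ, |t₁| < ε → |t₂| < ε → t₁ ≠ t₂ → α u t₁ = α u t₂ →
          ({t₁, t₂} : Set ℝ) = {Real.sqrt (-u), -Real.sqrt (-u)}) ∧
       (∀ t : ℝ, |t| < ε → (-2*u + 6*t^2 = 0 ↔
          0 < u ∧ (t = Real.sqrt (u/3) ∨ t = -Real.sqrt (u/3)))) ∧
       (∀ t : ℝ, |t| < ε → ((deriv (β u) t = 2*t ∨ deriv (β u) t = -2*t) ↔
          (t = (1 - Real.sqrt (1 - 3*u))/3 ∨ t = (-1 + Real.sqrt (1 - 3*u))/3))) ∧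
       (u < 0 →
          (-Real.sqrt (-u) < (1 - Real.sqrt (1 - 3*u))/3 ∧
            (1 - Real.sqrt (1 - 3*u))/3 < Real.sqrt (-u)) ∧
          (-Real.sqrt (-u) < (-1 + Real.sqrt (1 - 3*u))/3 ∧
            (-1 + Real.sqrt (1 - 3*u))/3 < Real.sqrt (-u)))) := by
  refine ⟨1 / 3, by norm_num, 1 / 10, by norm_num, fun u hu0 hu => ?_⟩
  have hu0 : u ≠ 0 := abs_pos.mp hu0
  obtain ⟨hul, hur⟩ := abs_lt.mp hu
  have key : ∀ a b : ℝ, a ≠ b → α u a = α u b → b = -a ∧ a ^ 2 = -u := by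
    intro a b hne h
    simp only [hα, hβ, Prod.mk.injEq] at h
    exact eq_neg_and_sq_of_cusp_deformation_self_intersection hne h.1 h.2
  refine ⟨⟨?_, ?_⟩, ?_, ?_, ?_, ?_⟩
  · rintro ⟨a, b, -, -, hne, h⟩
    obtain ⟨-, hsq⟩ := key a b hne h
    exact lt_of_le_of_ne (by nlinarith [sq_nonneg a]) hu0
  · intro hneg
    have hpos : 0 < Real.sqrt (-u) := Real.sqrt_pos.mpr (by linarith)
    have hsq : Real.sqrt (-u) ^ 2 = -u := Real.sq_sqrt (by linarith)
    have hlt : |Real.sqrt (-u)| < 1 / 3 := by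
      rw [abs_of_pos hpos]
      nlinarith
    refine ⟨Real.sqrt (-u), -Real.sqrt (-u), hlt, by rwa [abs_neg], by linarith, ?_⟩
    simp only [hα, hβ, Prod.mk.injEq]
    refine ⟨by ring, ?_⟩
    linear_combination 2 * Real.sqrt (-u) * hsq
  · intro a b _ _ hne h
    obtain ⟨rfl, hsq⟩ := key a b hne h
    rcases eq_sqrt_or_eq_neg_sqrt_of_sq_eq hsq with h | h
    · rw [h]
    · rw [h, neg_neg, Set.pair_comm]
  · intro t _
    constructor
    · intro h
      have hsq : t ^ 2 = u / 3 := by linarith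
      exact ⟨lt_of_le_of_ne (by nlinarith [sq_nonneg t]) hu0.symm,
        eq_sqrt_or_eq_neg_sqrt_of_sq_eq hsq⟩
    · rintro ⟨hpos, h⟩
      have hsq : Real.sqrt (u / 3) ^ 2 = u / 3 := Real.sq_sqrt (by linarith)
      rcases h with rfl | rfl
      · linarith
      · rw [neg_sq]
        linarith
  · intro t ht
    obtain ⟨htl, htr⟩ := abs_lt.mp ht
    rw [show β u = fun t => u * t + t ^ 3 from funext (hβ u), deriv_mul_add_cube]
    have hsq : Real.sqrt (1 - 3 * u) ^ 2 = 1 - 3 * u := Real.sq_sqrt (by linarith)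
    constructor
    · rintro (h | h)
      · left
        rw [show 1 - 3 * u = (1 - 3 * t) ^ 2 by linarith, Real.sqrt_sq (by linarith)]
        ring
      · right
        rw [show 1 - 3 * u = (1 + 3 * t) ^ 2 by linarith, Real.sqrt_sq (by linarith)]
        ring
    · rintro (h | h)
      · left
        rw [h]
        linear_combination hsq / 3
      · right
        rw [h]
        linear_combination hsq / 3
  · intro hneg
    have hpos : 0 < Real.sqrt (-u) := Real.sqrt_pos.mpr (by linarith)
    have hsq : Real.sqrt (-u) ^ 2 = -u := Real.sq_sqrt (by linarith)
    have hone : 1 < Real.sqrt (1 - 3 * u) := Real.lt_sqrt_of_sq_lt (by linarith)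
    have hlt : Real.sqrt (1 - 3 * u) < 1 + 3 * Real.sqrt (-u) := by
      rw [Real.sqrt_lt' (by linarith)]
      nlinarith
    refine ⟨⟨?_, ?_⟩, ?_, ?_⟩ <;> linarith
end

section
/- Consider the model family α_{(u₁,u₂)}(t) = (t², β_{(u₁,u₂)}(t)) with β_{(u₁,u₂)}(t) = u₁·t + (1 + u₂)·t² + t³ of deformations of a lightlike ordinary cusp. Then for (u₁,u₂) ∈ ℝ² there exists t ∈ ℝ with β_{(u₁,u₂)}'(t) = 2t and β_{(u₁,u₂)}''(t) = 2 (i.e. the deformed curve has a lightlike inflection at parameter t) if and only if 3u₁ = u₂², in which case t = −u₂/3. Thus the lightlike-inflection stratum LI in the parameter space of the model family is exactly the parabola {(u₁,u₂) : 3u₁ = u₂²} = {(3s², −3s) : s ∈ ℝ}. -/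
open Filter Topology

theorem deriv_cubic (a b c : ℝ) :
    deriv (fun t : ℝ => a * t + b * t ^ 2 + c * t ^ 3) =
      fun t => a + 2 * b * t + 3 * c * t ^ 2 := by
  funext t
  have h := (((hasDerivAt_id t).const_mul a).add ((hasDerivAt_pow 2 t).const_mul b)).add
    ((hasDerivAt_pow 3 t).const_mul c)
  refine (h.congr_deriv ?_).deriv
  norm_num
  ring

theorem iteratedDeriv_two_cubic (a b c : ℝ) :
    iteratedDeriv 2 (fun t : ℝ => a * t + b * t ^ 2 + c * t ^ 3) =
      fun t => 2 * b + 6 * c * t := by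
  rw [iteratedDeriv_succ, iteratedDeriv_one, deriv_cubic]
  funext t
  have h := (((hasDerivAt_id t).const_mul (2 * b)).const_add a).add
    ((hasDerivAt_pow 2 t).const_mul (3 * c))
  refine (h.congr_deriv ?_).deriv
  norm_num
  ring

/-- In the model family β_u(t) = u₁t + (1+u₂)t² + t³ of deformations of a lightlike ordinary
cusp, the deformed curve (t², β_u(t)) has a lightlike inflection (β_u'(t) = 2t and
β_u''(t) = 2) at some parameter t iff 3u₁ = u₂², in which case t = -u₂/3; so the stratum
LI is exactly the parabola {(3s², -3s) : s ∈ ℝ}. -/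
theorem stmt_17 (β : ℝ × ℝ → ℝ → ℝ)
    (hβ : ∀ u t, β u t = u.1 * t + (1 + u.2) * t^2 + t^3) :
    (∀ u : ℝ × ℝ,
      (∃ t : ℝ, deriv (β u) t = 2*t ∧ iteratedDeriv 2 (β u) t = 2) ↔ 3*u.1 = u.2^2) ∧
    (∀ u : ℝ × ℝ, ∀ t : ℝ,
      deriv (β u) t = 2*t → iteratedDeriv 2 (β u) t = 2 → t = -u.2/3) ∧
    {u : ℝ × ℝ | 3*u.1 = u.2^2} = {p : ℝ × ℝ | ∃ s : ℝ, p = (3*s^2, -3*s)} := by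
  have hfun (u : ℝ × ℝ) : β u = fun t => u.1 * t + (1 + u.2) * t ^ 2 + 1 * t ^ 3 := by
    funext t
    rw [hβ, one_mul]
  simp only [hfun, deriv_cubic, iteratedDeriv_two_cubic]
  refine ⟨fun u => ⟨?_, fun h => ⟨-u.2 / 3, ?_, ?_⟩⟩, fun u t _ h₂ => by linarith, ?_⟩
  · rintro ⟨t, h₁, h₂⟩
    obtain rfl : t = -u.2 / 3 := by linarith
    linarith
  · linarith
  · ring
  · ext ⟨x, y⟩
    simp only [Set.mem_ofPred_eq, Prod.mk.injEq]
    constructor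
    · intro h
      exact ⟨-y / 3, by linarith, by ring⟩
    · rintro ⟨s, rfl, rfl⟩
      ring
end

section
/- Consider the model family α_{(u₁,u₂)}(t) = (t², β_{(u₁,u₂)}(t)) with β_{(u₁,u₂)}(t) = u₁·t + (1 + u₂)·t² + t³ of deformations of a lightlike ordinary cusp. Then for (u₁,u₂) ∈ ℝ² there exists t ≠ 0 with β_{(u₁,u₂)}(t) = β_{(u₁,u₂)}(−t) and β_{(u₁,u₂)}'(t) = 2t (i.e. the deformed curve has a self-intersection point one of whose branches is lightlike) if and only if u₂ ≠ 0 and u₁ = −u₂², in which case t = −u₂. Thus the stratum LT in the parameter space of the model family is exactly {(−s², −s) : s ∈ ℝ, s ≠ 0}. -/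
open Filter Topology

theorem deriv_cubic_without_const (a b t : ℝ) :
    deriv (fun t : ℝ => a * t + b * t^2 + t^3) t = a + 2 * b * t + 3 * t^2 := by
  have h := (((hasDerivAt_id t).const_mul a).add ((hasDerivAt_pow 2 t).const_mul b)).add
    (hasDerivAt_pow 3 t)
  refine HasDerivAt.deriv (h.congr_deriv ?_)
  norm_num
  ring

/-- In the model family β_u(t) = u₁t + (1+u₂)t² + t³ of deformations of a lightlike ordinary
cusp, the deformed curve (t², β_u(t)) has a self-intersection with a lightlike branch
(t ≠ 0 with β_u(t) = β_u(-t) and β_u'(t) = 2t) iff u₂ ≠ 0 and u₁ = -u₂², in which case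
t = -u₂; so the stratum LT is exactly {(-s², -s) : s ≠ 0}. -/
theorem stmt_18 (β : ℝ × ℝ → ℝ → ℝ)
    (hβ : ∀ u t, β u t = u.1 * t + (1 + u.2) * t^2 + t^3) :
    (∀ u : ℝ × ℝ,
      (∃ t : ℝ, t ≠ 0 ∧ β u t = β u (-t) ∧ deriv (β u) t = 2*t) ↔
        (u.2 ≠ 0 ∧ u.1 = -u.2^2)) ∧
    (∀ u : ℝ × ℝ, ∀ t : ℝ,
      t ≠ 0 → β u t = β u (-t) → deriv (β u) t = 2*t → t = -u.2) ∧
    {u : ℝ × ℝ | u.2 ≠ 0 ∧ u.1 = -u.2^2} =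
      {p : ℝ × ℝ | ∃ s : ℝ, s ≠ 0 ∧ p = (-s^2, -s)} := by
  have hderiv (u : ℝ × ℝ) (t : ℝ) :
      deriv (β u) t = u.1 + 2 * (1 + u.2) * t + 3 * t^2 := by
    rw [funext (hβ u), deriv_cubic_without_const]
  have key (u : ℝ × ℝ) (t : ℝ) (ht : t ≠ 0) (hs : β u t = β u (-t))
      (hd : deriv (β u) t = 2*t) : u.1 = -t^2 ∧ t = -u.2 := by
    rw [hβ, hβ] at hs
    rw [hderiv] at hd
    have h₁ : u.1 = -t^2 := mul_left_cancel₀ ht (by linarith)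
    exact ⟨h₁, mul_left_cancel₀ ht (by linarith)⟩
  refine ⟨fun u => ⟨?_, ?_⟩, fun u t ht hs hd => (key u t ht hs hd).2, ?_⟩
  · rintro ⟨t, ht, hs, hd⟩
    obtain ⟨h₁, rfl⟩ := key u t ht hs hd
    exact ⟨neg_ne_zero.mp ht, by rwa [neg_sq] at h₁⟩
  · rintro ⟨h₂, h₁⟩
    refine ⟨-u.2, neg_ne_zero.mpr h₂, ?_, ?_⟩
    · rw [hβ, hβ, h₁]
      ring
    · rw [hderiv, h₁]
      ring
  · ext ⟨a, b⟩
    constructor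
    · rintro ⟨hb, ha⟩
      exact ⟨-b, neg_ne_zero.mpr hb, by simpa using ha⟩
    · rintro ⟨s, hs, h⟩
      obtain ⟨rfl, rfl⟩ := Prod.mk.inj h
      exact ⟨neg_ne_zero.mpr hs, by simp⟩
end

section
/- Let β : ℝ → ℝ be smooth with β(0) = β'(0) = β''(0) = β'''(0) = 0, β''''(0) = 24c₄ with c₄ ≠ 0, and β^{(5)}(0) = 120c₅, so that γ(t) = (t², β(t)) has a non-lightlike ramphoid cusp at t = 0. Then β'(t) − t·β''(t) ≠ 0 for all sufficiently small t ≠ 0, and the branch u(t) = (u₁(t), u₂(t)) of the caustic of γ given by u₂(t) = β(t) − (t·β'(t)² − 4t³)/(β'(t) − t·β''(t)) and u₁(t) = 3t² − (β''(t)·(β(t) − u₂(t)) + β'(t)²)/2 satisfies lim_{t→0} u₁(t)/t³ = 5c₅/(8c₄), lim_{t→0} u₂(t) = −1/(2c₄), and lim_{t→0} (u₂(t) + 1/(2c₄))/t = 15c₅/(16c₄²); in particular if c₅ ≠ 0 this branch is a regular curve through the point (0, −1/(2c₄)) transverse to the limiting tangent line u₁ = 0 of γ. -/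
open Filter Topology

/-- If the derivatives of `f` of order less than `n` vanish at `0`, then `f t / t ^ n` has a first
order expansion at `0` whose coefficients are the next two Taylor coefficients of `f`. -/
theorem tendsto_div_pow_sub_div_of_iteratedDeriv_eq_zero {f : ℝ → ℝ} {n : ℕ}
    (hf : ContDiff ℝ (n + 1 : ℕ) f) (hz : ∀ k < n, iteratedDeriv k f 0 = 0) :
    Tendsto (fun t => (f t / t ^ n - iteratedDeriv n f 0 / n.factorial) / t) (𝓝[≠] (0 : ℝ))
      (𝓝 (iteratedDeriv (n + 1) f 0 / (n + 1).factorial)) := by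
  have h := (Real.taylor_tendsto (x₀ := 0) convex_univ (Set.mem_univ _)
    hf.contDiffOn).mono_left (nhdsWithin_mono (0 : ℝ) (Set.subset_univ {0}ᶜ))
  have hT : ∀ t, taylorWithinEval f (n + 1) Set.univ 0 t =
      iteratedDeriv n f 0 / n.factorial * t ^ n +
        iteratedDeriv (n + 1) f 0 / (n + 1).factorial * t ^ (n + 1) := by
    intro t
    rw [taylor_within_apply, Finset.sum_range_succ, Finset.sum_range_succ, Finset.sum_eq_zero]
    · simp only [iteratedDerivWithin_univ, sub_zero, smul_eq_mul]
      ring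
    · intro k hk
      simp [iteratedDerivWithin_univ, hz k (Finset.mem_range.mp hk)]
  have h' := h.add_const (iteratedDeriv (n + 1) f 0 / (n + 1).factorial)
  rw [zero_add] at h'
  refine h'.congr' ?_
  filter_upwards [self_mem_nhdsWithin] with t ht
  have ht : t ≠ 0 := ht
  rw [hT, sub_zero]
  generalize iteratedDeriv (n + 1) f 0 / (n + 1).factorial = a
  generalize iteratedDeriv n f 0 / n.factorial = b
  field_simp
  ring

/-- At a non-lightlike ramphoid cusp γ(t) = (t², β(t)) (β vanishing to order 4,
β''''(0) = 24c₄ ≠ 0, β⁽⁵⁾(0) = 120c₅), the non-linear branch of the caustic satisfies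
u₁(t)/t³ → 5c₅/(8c₄), u₂(t) → -1/(2c₄) and (u₂(t) + 1/(2c₄))/t → 15c₅/(16c₄²);
so for c₅ ≠ 0 it is a regular curve through (0, -1/(2c₄)) transverse to the limiting
tangent line u₁ = 0. -/
theorem stmt_19 (β : ℝ → ℝ) (hβ : ContDiff ℝ (⊤ : ℕ∞) β) (c₄ c₅ : ℝ) (hc₄ : c₄ ≠ 0)
    (h0 : β 0 = 0) (h1 : deriv β 0 = 0) (h2 : iteratedDeriv 2 β 0 = 0)
    (h3 : iteratedDeriv 3 β 0 = 0) (h4 : iteratedDeriv 4 β 0 = 24 * c₄)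
    (h5 : iteratedDeriv 5 β 0 = 120 * c₅)
    (u₁ u₂ : ℝ → ℝ)
    (hu₂ : ∀ t, u₂ t = β t - (t * (deriv β t)^2 - 4*t^3) /
        (deriv β t - t * iteratedDeriv 2 β t))
    (hu₁ : ∀ t, u₁ t = 3*t^2 -
        (iteratedDeriv 2 β t * (β t - u₂ t) + (deriv β t)^2) / 2) :
    (∀ᶠ t in 𝓝[≠] (0:ℝ), deriv β t - t * iteratedDeriv 2 β t ≠ 0) ∧
    Tendsto (fun t => u₁ t / t^3) (𝓝[≠] (0:ℝ)) (𝓝 (5*c₅/(8*c₄))) ∧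
    Tendsto (fun t => u₂ t) (𝓝[≠] (0:ℝ)) (𝓝 (-1/(2*c₄))) ∧
    Tendsto (fun t => (u₂ t + 1/(2*c₄)) / t) (𝓝[≠] (0:ℝ)) (𝓝 (15*c₅/(16*c₄^2))) := by
  have e2 : iteratedDeriv 2 β = deriv (deriv β) := by
    simp [iteratedDeriv_succ]
  have hβ1 : ContDiff ℝ (⊤ : ℕ∞) (deriv β) := (contDiff_infty_iff_deriv.mp hβ).2
  have hβ2 : ContDiff ℝ (⊤ : ℕ∞) (iteratedDeriv 2 β) := by
    rw [e2]
    exact (contDiff_infty_iff_deriv.mp hβ1).2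
  have hd1 : ∀ k, iteratedDeriv k (deriv β) 0 = iteratedDeriv (k + 1) β 0 := fun k => by
    rw [iteratedDeriv_succ']
  have hd2 : ∀ k, iteratedDeriv k (iteratedDeriv 2 β) 0 = iteratedDeriv (k + 2) β 0 := fun k => by
    rw [e2, iteratedDeriv_succ', iteratedDeriv_succ']
  obtain ⟨p, hpdef⟩ : ∃ p : ℝ → ℝ, p = fun t => (deriv β t / t ^ 3 - 4 * c₄) / t := ⟨_, rfl⟩
  obtain ⟨q, hqdef⟩ : ∃ q : ℝ → ℝ, q = fun t => (iteratedDeriv 2 β t / t ^ 2 - 12 * c₄) / t :=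
    ⟨_, rfl⟩
  obtain ⟨b, hbdef⟩ : ∃ b : ℝ → ℝ, b = fun t => β t / t := ⟨_, rfl⟩
  have hp : Tendsto p (𝓝[≠] 0) (𝓝 (5 * c₅)) := by
    have h := tendsto_div_pow_sub_div_of_iteratedDeriv_eq_zero (n := 3)
      (contDiff_infty.mp hβ1 _) (by
        intro k hk
        rw [hd1]
        interval_cases k <;> simp [iteratedDeriv_one, h1, h2, h3])
    rw [hd1, hd1, h4, h5] at h
    rw [hpdef]
    convert h using 1
    · ext t; norm_num [Nat.factorial]; ring
    · norm_num [Nat.factorial]; ring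
  have hq : Tendsto q (𝓝[≠] 0) (𝓝 (20 * c₅)) := by
    have h := tendsto_div_pow_sub_div_of_iteratedDeriv_eq_zero (n := 2)
      (contDiff_infty.mp hβ2 _) (by
        intro k hk
        rw [hd2]
        interval_cases k <;> simp [h2, h3])
    rw [hd2, hd2, h4, h5] at h
    rw [hqdef]
    convert h using 1
    · ext t; norm_num [Nat.factorial]; ring
    · norm_num [Nat.factorial]; ring
  have hb : Tendsto b (𝓝[≠] 0) (𝓝 0) := by
    have h := tendsto_div_pow_sub_div_of_iteratedDeriv_eq_zero (n := 0) (f := β)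
      (contDiff_infty.mp hβ _) (by simp)
    simpa [iteratedDeriv_one, h0, h1, hbdef] using h
  have hne : ∀ᶠ t in 𝓝[≠] (0 : ℝ), t ≠ 0 := self_mem_nhdsWithin
  have hpe : ∀ t ≠ 0, deriv β t = t ^ 3 * (4 * c₄ + p t * t) := fun t ht => by
    rw [hpdef]; field_simp; ring
  have hqe : ∀ t ≠ 0, iteratedDeriv 2 β t = t ^ 2 * (12 * c₄ + q t * t) := fun t ht => by
    rw [hqdef]; field_simp; ring
  have hbe : ∀ t ≠ 0, β t = b t * t := fun t ht => by
    rw [hbdef]; field_simp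
  clear hpdef hqdef hbdef
  have ht0 : Tendsto (fun t : ℝ => t) (𝓝[≠] 0) (𝓝 0) :=
    tendsto_nhdsWithin_of_tendsto_nhds tendsto_id
  obtain ⟨E, hE⟩ : ∃ E : ℝ → ℝ, ∀ t, E t = -8 * c₄ + (p t - q t) * t := ⟨_, fun _ => rfl⟩
  have hElim : Tendsto E (𝓝[≠] 0) (𝓝 (-8 * c₄)) := by
    have h := ((hp.sub hq).mul ht0).const_add (-8 * c₄)
    rw [mul_zero, add_zero] at h
    exact h.congr fun t => (hE t).symm
  have h8 : -8 * c₄ ≠ 0 := mul_ne_zero (by norm_num) hc₄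
  have hEne : ∀ᶠ t in 𝓝[≠] (0 : ℝ), E t ≠ 0 := hElim.eventually_ne h8
  have hDe : ∀ t ≠ 0, deriv β t - t * iteratedDeriv 2 β t = t ^ 3 * E t := fun t ht => by
    rw [hpe t ht, hqe t ht, hE]; ring
  have hPlim : Tendsto (fun t => 4 * c₄ + p t * t) (𝓝[≠] 0) (𝓝 (4 * c₄)) := by
    simpa using (hp.mul ht0).const_add (4 * c₄)
  have hQlim : Tendsto (fun t => 12 * c₄ + q t * t) (𝓝[≠] 0) (𝓝 (12 * c₄)) := by
    simpa using (hq.mul ht0).const_add (12 * c₄)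
  have hw : Tendsto (fun t => (u₂ t + 1/(2*c₄)) / t) (𝓝[≠] (0:ℝ)) (𝓝 (15*c₅/(16*c₄^2))) := by
    have h := (hb.sub (((ht0.pow 3).mul (hPlim.pow 2)).div hElim h8)).add
      ((hp.sub hq).div (hElim.const_mul (2 * c₄)) (mul_ne_zero (by simpa using hc₄) h8))
    have hval : (0 - 0 ^ 3 * (4 * c₄) ^ 2 / (-8 * c₄) +
        (5 * c₅ - 20 * c₅) / (2 * c₄ * (-8 * c₄))) = 15*c₅/(16*c₄^2) := by
      field_simp; ring
    rw [hval] at h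
    refine h.congr' ?_
    filter_upwards [hne, hEne] with t ht hEt
    have hpq : p t - q t = (E t + 8 * c₄) / t := by
      rw [hE]; field_simp; ring
    simp only [Pi.div_apply]
    rw [hu₂, hDe t ht, hpe t ht, hbe t ht, hpq]
    field_simp
    ring
  have hu : Tendsto (fun t => u₂ t) (𝓝[≠] (0:ℝ)) (𝓝 (-1/(2*c₄))) := by
    have h := (hw.mul ht0).sub_const (1/(2*c₄))
    rw [mul_zero, zero_sub, ← neg_div] at h
    refine h.congr' ?_
    filter_upwards [hne] with t ht
    field_simp
    ring
  refine ⟨?_, ?_, hu, hw⟩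
  · filter_upwards [hne, hEne] with t ht hEt
    rw [hDe t ht]
    exact mul_ne_zero (pow_ne_zero 3 ht) hEt
  · have h := ((hq.div_const (4 * c₄)).neg.sub ((hQlim.mul (hb.sub hw)).div_const 2)).sub
      (((ht0.pow 3).mul (hPlim.pow 2)).div_const 2)
    have hval : -(20 * c₅ / (4 * c₄)) - 12 * c₄ * (0 - 15*c₅/(16*c₄^2)) / 2 -
        0 ^ 3 * (4 * c₄) ^ 2 / 2 = 5*c₅/(8*c₄) := by
      field_simp; ring
    rw [hval] at h
    refine h.congr' ?_
    filter_upwards [hne] with t ht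
    rw [hu₁, hpe t ht, hqe t ht, hbe t ht]
    field_simp
    ring
end
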